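/- arXiv:2407.11331 — 2 statements merged into one kernel-verified Lean document; each statement's English description precedes it below -/
import Mathlib

section
/- Let B ∈ 𝒰⁴ satisfy e_i + e_j ∉ B for every pair of distinct indices i, j ∈ {1,2,3,4}. Then there exist real numbers 0 < ζ < η < δ < 1 and a permutation σ of the coordinates {1,2,3,4} such that the set obtained by applying σ to the 14-element set {±(1,δ,η,0), ±(δ,−1,−η,0), ±(δ,−η,1,ζ), ±(−δ,−η,1,ζ), ±(0,η,δ,1), ±(0,−η,−δ,1), ±(0,1,−δ,η)} illuminates B. In particular 𝕀(B) ≤ 14 = 2⁴ − 2. -/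
open Set

/-- A convex body in `ℝ^n`: a compact convex set with nonempty interior. -/
def IsConvexBody {n : ℕ} (K : Set (Fin n → ℝ)) : Prop :=
  Convex ℝ K ∧ IsCompact K ∧ (interior K).Nonempty

/-- `K` is 1-unconditional: closed under sign changes of the coordinates. -/
def Unconditional {n : ℕ} (K : Set (Fin n → ℝ)) : Prop :=
  ∀ x ∈ K, ∀ ε : Fin n → ℝ, (∀ i, ε i = 1 ∨ ε i = -1) → (fun i => ε i * x i) ∈ K

/-- The direction `d` illuminates the (boundary) point `x` of `K`. -/
def Illuminates {n : ℕ} (K : Set (Fin n → ℝ)) (d x : Fin n → ℝ) : Prop :=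
  ∃ ε : ℝ, 0 < ε ∧ x + ε • d ∈ interior K

/-- The set of directions `D` illuminates every boundary point of `K`. -/
def IlluminatesSet {n : ℕ} (K : Set (Fin n → ℝ)) (D : Set (Fin n → ℝ)) : Prop :=
  ∀ x ∈ frontier K, ∃ d ∈ D, Illuminates K d x

/-- The illumination number: smallest cardinality of a set of nonzero directions
illuminating `K`. -/
noncomputable def illumNumber {n : ℕ} (K : Set (Fin n → ℝ)) : ℕ :=
  sInf {m | ∃ D : Finset (Fin n → ℝ), D.card = m ∧ (∀ d ∈ D, d ≠ 0) ∧
    IlluminatesSet K ↑D}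

/-- A parallelepiped: an affine image of the cube `[-1,1]^n`. -/
def IsParallelepiped {n : ℕ} (K : Set (Fin n → ℝ)) : Prop :=
  ∃ T : (Fin n → ℝ) ≃ᵃ[ℝ] (Fin n → ℝ),
    K = T '' (Set.Icc (fun _ => (-1 : ℝ)) (fun _ => 1))

/-- The standard basis vector `e i`. -/
def stdB {n : ℕ} (i : Fin n) : Fin n → ℝ := Pi.single i 1

/-- The class `𝒰^n`: 1-unconditional convex bodies all of whose standard basis
vectors lie on the boundary. -/
def memU {n : ℕ} (K : Set (Fin n → ℝ)) : Prop :=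
  IsConvexBody K ∧ Unconditional K ∧ ∀ i : Fin n, stdB i ∈ frontier K

/-- A 1-unconditional body is cubelike if all its extreme points have all
coordinates nonzero. -/
def Cubelike {n : ℕ} (K : Set (Fin n → ℝ)) : Prop :=
  ∀ x ∈ Set.extremePoints ℝ K, ∀ i, x i ≠ 0

/-- The all-ones vector `𝟙`. -/
def allOnes {n : ℕ} : Fin n → ℝ := fun _ => 1


/-- The fourteen directions. -/
def dirs (δ η ζ : ℝ) : Set (Fin 4 → ℝ) :=
  {![1, δ, η, 0], -![1, δ, η, 0],
            ![δ, -1, -η, 0], -![δ, -1, -η, 0],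
            ![δ, -η, 1, ζ], -![δ, -η, 1, ζ],
            ![-δ, -η, 1, ζ], -![-δ, -η, 1, ζ],
            ![0, η, δ, 1], -![0, η, δ, 1],
            ![0, -η, -δ, 1], -![0, -η, -δ, 1],
            ![0, 1, -δ, η], -![0, 1, -δ, η]}

set_option maxHeartbeats 1000000 in
theorem keyineq {δ η ζ m a p b q c r e s : ℝ} (hm : 0 < m) (hζ : 0 < ζ)
    (hζη : ζ < η * m) (hηδ : 2 * η < δ * m) (hδm : 3 * δ < m) (hm1 : m ≤ 1 / 2)
    (hp : 0 ≤ p) (hq : 0 ≤ q) (hr : 0 ≤ r) (hs : 0 ≤ s)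
    (hpa : p ≤ a) (hqb : q ≤ b) (hrc : r ≤ c) (hse : s ≤ e)
    (ha : a ≤ 1) (hb : b ≤ 1) (hc : c ≤ 1) (he : e ≤ 1)
    (hsum : p + q + r + s = 1) :
    (s ≤ 1 - m → 0 < a + δ * b + η * c ∧ 0 < δ * a + b + η * c ∧
      ζ * e < δ * a + η * b + c ∧
      (r = 0 → η * c < a + δ * b ∧ η * c < δ * a + b) ∧
      (q = 0 → η * b + ζ * e < δ * a + c) ∧
      (p = 0 → η * e < b + δ * c) ∧
      (q = 0 → r = 0 → δ * b + η * c < a) ∧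
      (p = 0 → r = 0 → δ * a + η * c < b) ∧
      (p = 0 → q = 0 → δ * a + η * b + ζ * e < c)) ∧
    (p = 0 → s = 0 → q ≤ 1 - 2 * m → δ * a + η * b + ζ * e < c) ∧
    (p = 0 → s = 0 → r ≤ 1 - 2 * m → δ * a + η * c < b) ∧
    (p ≤ 1 - 2 * m → 0 < η * b + δ * c + e ∧ 0 < b + δ * c + η * e
      ∧ 0 < δ * a + η * b + c + ζ * e) ∧
    (p ≤ 1 - 2 * m → q ≤ 1 - 2 * m → p = 0 ∨ q = 0 → η * b < δ * c + e) ∧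
    (p ≤ 1 - 2 * m → q = 0 → r = 0 → η * b + δ * c < e) := by
  have hη : 0 < η := by nlinarith
  have hδ : 0 < δ := by nlinarith
  have hδ1 : δ < 1 / 6 := by linarith
  have hη1 : η < δ := by nlinarith
  have hζ1 : ζ < η := by nlinarith
  have ha0 := hp.trans hpa
  have hb0 := hq.trans hqb
  have hc0 := hr.trans hrc
  have he0 := hs.trans hse
  have da : δ * a ≤ δ := by nlinarith
  have ea : η * a ≤ η := by nlinarith
  have db : δ * b ≤ δ := by nlinarith
  have eb : η * b ≤ η := by nlinarith
  have dc : δ * c ≤ δ := by nlinarith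
  have ec : η * c ≤ η := by nlinarith
  have ee : η * e ≤ η := by nlinarith
  have ze : ζ * e ≤ ζ := by nlinarith
  have da0 : 0 ≤ δ * a := by positivity
  have db0 : 0 ≤ δ * b := by positivity
  have dc0 : 0 ≤ δ * c := by positivity
  have de0 : 0 ≤ δ * e := by positivity
  have ea0 : 0 ≤ η * a := by positivity
  have eb0 : 0 ≤ η * b := by positivity
  have ec0 : 0 ≤ η * c := by positivity
  have ee0 : 0 ≤ η * e := by positivity
  have ze0 : 0 ≤ ζ * e := by positivity
  have xa : η * a ≤ δ * a := by nlinarith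
  have xb : η * b ≤ δ * b := by nlinarith
  have xc : η * c ≤ δ * c := by nlinarith
  have ya : δ * a ≤ a := by nlinarith
  have yb : δ * b ≤ b := by nlinarith
  have yc : δ * c ≤ c := by nlinarith
  have ye : δ * e ≤ e := by nlinarith
  have hηm : 0 < η * m := by positivity
  refine ⟨fun h => ?_, ?_, ?_, ?_, ?_, ?_⟩
  · have habc : η * m ≤ η * (a + b + c) := by
      apply mul_le_mul_of_nonneg_left _ hη.le; linarith
    have habc' : δ * m ≤ δ * (a + b + c) := by
      apply mul_le_mul_of_nonneg_left _ hδ.le; linarith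
    refine ⟨by linarith, by linarith, by linarith, fun h0 => ?_, fun h0 => ?_, fun h0 => ?_,
      fun h0 h1 => by linarith, fun h0 h1 => by linarith, fun h0 h1 => by linarith⟩
    · have : δ * m ≤ δ * (a + b) := by
        apply mul_le_mul_of_nonneg_left _ hδ.le; linarith
      constructor <;> linarith
    · have : δ * m ≤ δ * (a + c) := by
        apply mul_le_mul_of_nonneg_left _ hδ.le; linarith
      linarith
    · have : δ * m ≤ δ * (b + c) := by
        apply mul_le_mul_of_nonneg_left _ hδ.le; linarith
      linarith
  · intro h0 h1 h2; linarith
  · intro h0 h1 h2; linarith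
  · intro h
    have h2 : η * (2 * m) ≤ η * (b + c + e) := by
      apply mul_le_mul_of_nonneg_left _ hη.le; linarith
    have h3 : 0 < ζ * (b + c + e) := mul_pos hζ (by linarith)
    have zb : ζ * b ≤ η * b := by nlinarith
    have zc : ζ * c ≤ η * c := by nlinarith
    refine ⟨by linarith [mul_le_mul_of_nonneg_right hη1.le he0], by linarith, by linarith⟩
  · intro h1 h2 h3
    have : δ * m ≤ δ * (c + e) := by
      apply mul_le_mul_of_nonneg_left _ hδ.le
      rcases h3 with h3 | h3 <;> linarith
    linarith
  · intro h0 h1 h2; linarith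

set_option linter.unusedSimpArgs false in
set_option maxHeartbeats 1000000 in
theorem core (δ η ζ m : ℝ) (hm : 0 < m) (hζ : 0 < ζ)
    (hζη : ζ < η * m) (hηδ : 2 * η < δ * m) (hδm : 3 * δ < m) (hm1 : m ≤ 1 / 2)
    (x : Fin 4 → ℝ) (P : (Fin 4 → ℝ) → Prop)
    (hx1 : ∀ i, |x i| ≤ 1)
    (hpair : ∀ i j, i ≠ j → |x i| ≤ 1 - 2 * m ∨ |x j| ≤ 1 - 2 * m)
    (hP : ∀ u, P u → (∀ i, |u i| ≤ 1) ∧ (∀ i, 0 ≤ u i * x i) ∧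
      u 0 * x 0 + u 1 * x 1 + u 2 * x 2 + u 3 * x 3 = 1)
    (hbad : x 2 = 0 → 1 - m < |x 3| → ∀ u, P u → δ * |u 2| < η * |u 1| + |u 3|) :
    ∃ d ∈ dirs δ η ζ, ∀ u, P u → u 0 * d 0 + u 1 * d 1 + u 2 * d 2 + u 3 * d 3 < 0 := by
  have hη : 0 < η := by nlinarith
  have hδ : 0 < δ := by nlinarith
  have pos : ∀ i, 0 < x i → ∀ u, P u → |u i| = u i := fun i hi u hu =>
    abs_of_nonneg (nonneg_of_mul_nonneg_left ((hP u hu).2.1 i) hi)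
  have neg : ∀ i, x i < 0 → ∀ u, P u → |u i| = - u i := fun i hi u hu =>
    abs_of_nonpos (by have := (hP u hu).2.1 i; nlinarith)
  have pa : ∀ u, P u → ∀ i, u i * x i ≤ |u i| := fun u hu i => by
    calc u i * x i ≤ |u i * x i| := le_abs_self _
      _ = |u i| * |x i| := abs_mul _ _
      _ ≤ _ := mul_le_of_le_one_right (abs_nonneg _) (hx1 i)
  have px : ∀ u, P u → ∀ i, u i * x i ≤ |x i| := fun u hu i => by
    calc u i * x i ≤ |u i * x i| := le_abs_self _
      _ = |u i| * |x i| := abs_mul _ _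
      _ ≤ _ := mul_le_of_le_one_left (abs_nonneg _) ((hP u hu).1 i)
  have pz : ∀ i, x i = 0 → ∀ u : Fin 4 → ℝ, u i * x i = 0 := fun i hi u => by rw [hi, mul_zero]
  have key := fun u (hu : P u) => keyineq (δ := δ) (η := η) (ζ := ζ) hm hζ hζη hηδ hδm hm1
    ((hP u hu).2.1 0) ((hP u hu).2.1 1) ((hP u hu).2.1 2) ((hP u hu).2.1 3)
    (pa u hu 0) (pa u hu 1) (pa u hu 2) (pa u hu 3)
    ((hP u hu).1 0) ((hP u hu).1 1) ((hP u hu).1 2) ((hP u hu).1 3) (hP u hu).2.2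
  have go : ∀ {d}, d ∈ dirs δ η ζ → ∀ e : Fin 4 → ℝ,
      (∀ i, 0 < x i ∧ d i = e i ∨ x i < 0 ∧ -d i = e i ∨ 0 ≤ e i ∧ (d i = e i ∨ -d i = e i)) →
      (∀ u, P u → e 0 * |u 0| + e 1 * |u 1| + e 2 * |u 2| + e 3 * |u 3| < 0) →
      ∃ d ∈ dirs δ η ζ, ∀ u, P u → u 0 * d 0 + u 1 * d 1 + u 2 * d 2 + u 3 * d 3 < 0 := by
    intro d hd e hc hk
    refine ⟨d, hd, fun u hu => ?_⟩
    have hle : ∀ i, u i * d i ≤ e i * |u i| := by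
      intro i
      rcases hc i with ⟨h, h'⟩ | ⟨h, h'⟩ | ⟨h, h' | h'⟩
      · rw [pos i h u hu, ← h', mul_comm]
      · rw [neg i h u hu, ← h']; linarith
      · rw [h']; nlinarith [le_abs_self (u i)]
      · rw [show d i = - e i by linarith]; nlinarith [neg_abs_le (u i)]
    linarith [hle 0, hle 1, hle 2, hle 3, hk u hu]
  have mem : ∀ d, (d = ![1, δ, η, 0] ∨ d = ![δ, -1, -η, 0] ∨ d = ![δ, -η, 1, ζ] ∨
      d = ![-δ, -η, 1, ζ] ∨ d = ![0, η, δ, 1] ∨ d = ![0, -η, -δ, 1] ∨ d = ![0, 1, -δ, η]) →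
      d ∈ dirs δ η ζ ∧ -d ∈ dirs δ η ζ := by
    rintro d (rfl | rfl | rfl | rfl | rfl | rfl | rfl) <;> simp [dirs]
  obtain ⟨mA, mA'⟩ := mem ![1, δ, η, 0] (by simp)
  obtain ⟨mG, mG'⟩ := mem ![δ, -1, -η, 0] (by simp)
  obtain ⟨mC, mC'⟩ := mem ![δ, -η, 1, ζ] (by simp)
  obtain ⟨mH, mH'⟩ := mem ![-δ, -η, 1, ζ] (by simp)
  obtain ⟨mE, mE'⟩ := mem ![0, η, δ, 1] (by simp)
  obtain ⟨mK, mK'⟩ := mem ![0, -η, -δ, 1] (by simp)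
  obtain ⟨mF, mF'⟩ := mem ![0, 1, -δ, η] (by simp)
  have k4 : |x 3| ≤ 1 - m → ∀ u, P u → u 3 * x 3 ≤ 1 - m := fun h u hu => (px u hu 3).trans h
  rcases le_or_gt |x 3| (1 - m) with h4 | h4
  · rcases lt_trichotomy (x 0) 0 with h0 | h0 | h0
    · rcases lt_trichotomy (x 1) 0 with h1 | h1 | h1
      · rcases lt_trichotomy (x 2) 0 with h2 | h2 | h2
        · exact go mA ![-1, -δ, -η, 0] (by simp [Fin.forall_fin_succ, h0, h1, h2, hδ.le, hη.le, hζ.le]) fun u hu => by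
            simp; linarith [((key u hu).1 (k4 h4 u hu)).1]
        · exact go mA ![-1, -δ, η, 0] (by simp [Fin.forall_fin_succ, h0, h1, hδ.le, hη.le, hζ.le]) fun u hu => by
            simp; linarith [(((key u hu).1 (k4 h4 u hu)).2.2.2.1 (pz 2 h2 u)).1]
        · exact go mH' ![-δ, -η, -1, ζ] (by simp [Fin.forall_fin_succ, h0, h1, h2, hδ.le, hη.le, hζ.le]) fun u hu => by
            simp; linarith [((key u hu).1 (k4 h4 u hu)).2.2.1]
      · rcases lt_trichotomy (x 2) 0 with h2 | h2 | h2
        · exact go mC ![-δ, η, -1, ζ] (by simp [Fin.forall_fin_succ, h0, h2, hδ.le, hη.le, hζ.le]) fun u hu => by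
            simp; linarith [((key u hu).1 (k4 h4 u hu)).2.2.2.2.1 (pz 1 h1 u)]
        · exact go mA ![-1, δ, η, 0] (by simp [Fin.forall_fin_succ, h0, hδ.le, hη.le, hζ.le]) fun u hu => by
            simp; linarith [((key u hu).1 (k4 h4 u hu)).2.2.2.2.2.2.1 (pz 1 h1 u) (pz 2 h2 u)]
        · exact go mH' ![-δ, η, -1, ζ] (by simp [Fin.forall_fin_succ, h0, h2, hδ.le, hη.le, hζ.le]) fun u hu => by
            simp; linarith [((key u hu).1 (k4 h4 u hu)).2.2.2.2.1 (pz 1 h1 u)]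
      · rcases lt_trichotomy (x 2) 0 with h2 | h2 | h2
        · exact go mC ![-δ, -η, -1, ζ] (by simp [Fin.forall_fin_succ, h0, h1, h2, hδ.le, hη.le, hζ.le]) fun u hu => by
            simp; linarith [((key u hu).1 (k4 h4 u hu)).2.2.1]
        · exact go mG ![-δ, -1, η, 0] (by simp [Fin.forall_fin_succ, h0, h1, hδ.le, hη.le, hζ.le]) fun u hu => by
            simp; linarith [(((key u hu).1 (k4 h4 u hu)).2.2.2.1 (pz 2 h2 u)).2]
        · exact go mG ![-δ, -1, -η, 0] (by simp [Fin.forall_fin_succ, h0, h1, h2, hδ.le, hη.le, hζ.le]) fun u hu => by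
            simp; linarith [((key u hu).1 (k4 h4 u hu)).2.1]
    · rcases lt_trichotomy (x 1) 0 with h1 | h1 | h1
      · rcases lt_trichotomy (x 2) 0 with h2 | h2 | h2
        · rcases lt_trichotomy (x 3) 0 with h3 | h3 | h3
          · exact go mE ![0, -η, -δ, -1] (by simp [Fin.forall_fin_succ, h1, h2, h3, hδ.le, hη.le, hζ.le]) fun u hu => by
              simp; linarith [((key u hu).2.2.2.1 (by rw [pz 0 h0 u]; linarith)).1]
          · rcases hpair 1 2 (by decide) with h5 | h5
            · exact go mC ![δ, η, -1, ζ] (by simp [Fin.forall_fin_succ, h2, hδ.le, hη.le, hζ.le]) fun u hu => by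
                simp; linarith [(key u hu).2.1 (pz 0 h0 u) (pz 3 h3 u) ((px u hu 1).trans h5)]
            · exact go mG' ![δ, -1, η, 0] (by simp [Fin.forall_fin_succ, h1, hδ.le, hη.le, hζ.le]) fun u hu => by
                simp; linarith [(key u hu).2.2.1 (pz 0 h0 u) (pz 3 h3 u) ((px u hu 2).trans h5)]
          · exact go mK' ![0, -η, -δ, -1] (by simp [Fin.forall_fin_succ, h1, h2, h3, hδ.le, hη.le, hζ.le]) fun u hu => by
              simp; linarith [((key u hu).2.2.2.1 (by rw [pz 0 h0 u]; linarith)).1]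
        · exact go mG' ![δ, -1, η, 0] (by simp [Fin.forall_fin_succ, h1, hδ.le, hη.le, hζ.le]) fun u hu => by
            simp; linarith [((key u hu).1 (k4 h4 u hu)).2.2.2.2.2.2.2.1 (pz 0 h0 u) (pz 2 h2 u)]
        · exact go mF ![0, -1, -δ, η] (by simp [Fin.forall_fin_succ, h1, h2, hδ.le, hη.le, hζ.le]) fun u hu => by
            simp; linarith [((key u hu).1 (k4 h4 u hu)).2.2.2.2.2.1 (pz 0 h0 u)]
      · rcases lt_trichotomy (x 2) 0 with h2 | h2 | h2
        · exact go mC ![δ, η, -1, ζ] (by simp [Fin.forall_fin_succ, h2, hδ.le, hη.le, hζ.le]) fun u hu => by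
            simp; linarith [((key u hu).1 (k4 h4 u hu)).2.2.2.2.2.2.2.2 (pz 0 h0 u) (pz 1 h1 u)]
        · refine ⟨![1, δ, η, 0], mA, fun u hu => ?_⟩
          linarith [(hP u hu).2.2, k4 h4 u hu, pz 0 h0 u, pz 1 h1 u, pz 2 h2 u]
        · exact go mC' ![δ, η, -1, ζ] (by simp [Fin.forall_fin_succ, h2, hδ.le, hη.le, hζ.le]) fun u hu => by
            simp; linarith [((key u hu).1 (k4 h4 u hu)).2.2.2.2.2.2.2.2 (pz 0 h0 u) (pz 1 h1 u)]
      · rcases lt_trichotomy (x 2) 0 with h2 | h2 | h2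
        · exact go mF' ![0, -1, -δ, η] (by simp [Fin.forall_fin_succ, h1, h2, hδ.le, hη.le, hζ.le]) fun u hu => by
            simp; linarith [((key u hu).1 (k4 h4 u hu)).2.2.2.2.2.1 (pz 0 h0 u)]
        · exact go mG ![δ, -1, η, 0] (by simp [Fin.forall_fin_succ, h1, hδ.le, hη.le, hζ.le]) fun u hu => by
            simp; linarith [((key u hu).1 (k4 h4 u hu)).2.2.2.2.2.2.2.1 (pz 0 h0 u) (pz 2 h2 u)]
        · rcases lt_trichotomy (x 3) 0 with h3 | h3 | h3
          · exact go mK ![0, -η, -δ, -1] (by simp [Fin.forall_fin_succ, h1, h2, h3, hδ.le, hη.le, hζ.le]) fun u hu => by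
              simp; linarith [((key u hu).2.2.2.1 (by rw [pz 0 h0 u]; linarith)).1]
          · rcases hpair 1 2 (by decide) with h5 | h5
            · exact go mC' ![δ, η, -1, ζ] (by simp [Fin.forall_fin_succ, h2, hδ.le, hη.le, hζ.le]) fun u hu => by
                simp; linarith [(key u hu).2.1 (pz 0 h0 u) (pz 3 h3 u) ((px u hu 1).trans h5)]
            · exact go mG ![δ, -1, η, 0] (by simp [Fin.forall_fin_succ, h1, hδ.le, hη.le, hζ.le]) fun u hu => by
                simp; linarith [(key u hu).2.2.1 (pz 0 h0 u) (pz 3 h3 u) ((px u hu 2).trans h5)]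
          · exact go mE' ![0, -η, -δ, -1] (by simp [Fin.forall_fin_succ, h1, h2, h3, hδ.le, hη.le, hζ.le]) fun u hu => by
              simp; linarith [((key u hu).2.2.2.1 (by rw [pz 0 h0 u]; linarith)).1]
    · rcases lt_trichotomy (x 1) 0 with h1 | h1 | h1
      · rcases lt_trichotomy (x 2) 0 with h2 | h2 | h2
        · exact go mG' ![-δ, -1, -η, 0] (by simp [Fin.forall_fin_succ, h0, h1, h2, hδ.le, hη.le, hζ.le]) fun u hu => by
            simp; linarith [((key u hu).1 (k4 h4 u hu)).2.1]
        · exact go mG' ![-δ, -1, η, 0] (by simp [Fin.forall_fin_succ, h0, h1, hδ.le, hη.le, hζ.le]) fun u hu => by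
            simp; linarith [(((key u hu).1 (k4 h4 u hu)).2.2.2.1 (pz 2 h2 u)).2]
        · exact go mC' ![-δ, -η, -1, ζ] (by simp [Fin.forall_fin_succ, h0, h1, h2, hδ.le, hη.le, hζ.le]) fun u hu => by
            simp; linarith [((key u hu).1 (k4 h4 u hu)).2.2.1]
      · rcases lt_trichotomy (x 2) 0 with h2 | h2 | h2
        · exact go mH ![-δ, η, -1, ζ] (by simp [Fin.forall_fin_succ, h0, h2, hδ.le, hη.le, hζ.le]) fun u hu => by
            simp; linarith [((key u hu).1 (k4 h4 u hu)).2.2.2.2.1 (pz 1 h1 u)]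
        · exact go mA' ![-1, δ, η, 0] (by simp [Fin.forall_fin_succ, h0, hδ.le, hη.le, hζ.le]) fun u hu => by
            simp; linarith [((key u hu).1 (k4 h4 u hu)).2.2.2.2.2.2.1 (pz 1 h1 u) (pz 2 h2 u)]
        · exact go mC' ![-δ, η, -1, ζ] (by simp [Fin.forall_fin_succ, h0, h2, hδ.le, hη.le, hζ.le]) fun u hu => by
            simp; linarith [((key u hu).1 (k4 h4 u hu)).2.2.2.2.1 (pz 1 h1 u)]
      · rcases lt_trichotomy (x 2) 0 with h2 | h2 | h2
        · exact go mH ![-δ, -η, -1, ζ] (by simp [Fin.forall_fin_succ, h0, h1, h2, hδ.le, hη.le, hζ.le]) fun u hu => by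
            simp; linarith [((key u hu).1 (k4 h4 u hu)).2.2.1]
        · exact go mA' ![-1, -δ, η, 0] (by simp [Fin.forall_fin_succ, h0, h1, hδ.le, hη.le, hζ.le]) fun u hu => by
            simp; linarith [(((key u hu).1 (k4 h4 u hu)).2.2.2.1 (pz 2 h2 u)).1]
        · exact go mA' ![-1, -δ, -η, 0] (by simp [Fin.forall_fin_succ, h0, h1, h2, hδ.le, hη.le, hζ.le]) fun u hu => by
            simp; linarith [((key u hu).1 (k4 h4 u hu)).1]
  · have d0 : |x 0| ≤ 1 - 2 * m := (hpair 0 3 (by decide)).resolve_right (by linarith)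
    have d1 : |x 1| ≤ 1 - 2 * m := (hpair 1 3 (by decide)).resolve_right (by linarith)
    rcases lt_trichotomy (x 3) 0 with h3 | h3 | h3
    · rcases lt_trichotomy (x 2) 0 with h2 | h2 | h2
      · rcases lt_trichotomy (x 1) 0 with h1 | h1 | h1
        · exact go mE ![0, -η, -δ, -1] (by simp [Fin.forall_fin_succ, h1, h2, h3, hδ.le, hη.le, hζ.le]) fun u hu => by
            simp; linarith [((key u hu).2.2.2.1 ((px u hu 0).trans d0)).1]
        · exact go mE ![0, η, -δ, -1] (by simp [Fin.forall_fin_succ, h2, h3, hδ.le, hη.le, hζ.le]) fun u hu => by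
            simp; linarith [(key u hu).2.2.2.2.1 ((px u hu 0).trans d0) ((px u hu 1).trans d1) (Or.inr (pz 1 h1 u))]
        · rcases lt_trichotomy (x 0) 0 with h0 | h0 | h0
          · exact go mC ![-δ, -η, -1, -ζ] (by simp [Fin.forall_fin_succ, h0, h1, h2, h3, hδ.le, hη.le, hζ.le]) fun u hu => by
              simp; linarith [((key u hu).2.2.2.1 ((px u hu 0).trans d0)).2.2]
          · exact go mE ![0, η, -δ, -1] (by simp [Fin.forall_fin_succ, h2, h3, hδ.le, hη.le, hζ.le]) fun u hu => by
              simp; linarith [(key u hu).2.2.2.2.1 ((px u hu 0).trans d0) ((px u hu 1).trans d1) (Or.inl (pz 0 h0 u))]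
          · exact go mH ![-δ, -η, -1, -ζ] (by simp [Fin.forall_fin_succ, h0, h1, h2, h3, hδ.le, hη.le, hζ.le]) fun u hu => by
              simp; linarith [((key u hu).2.2.2.1 ((px u hu 0).trans d0)).2.2]
      · rcases lt_trichotomy (x 1) 0 with h1 | h1 | h1
        · exact go mE ![0, -η, δ, -1] (by simp [Fin.forall_fin_succ, h1, h3, hδ.le, hη.le, hζ.le]) fun u hu => by
            simp; linarith [hbad h2 h4 u hu]
        · exact go mE ![0, η, δ, -1] (by simp [Fin.forall_fin_succ, h3, hδ.le, hη.le, hζ.le]) fun u hu => by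
            simp; linarith [(key u hu).2.2.2.2.2 ((px u hu 0).trans d0) (pz 1 h1 u) (pz 2 h2 u)]
        · exact go mK ![0, -η, δ, -1] (by simp [Fin.forall_fin_succ, h1, h3, hδ.le, hη.le, hζ.le]) fun u hu => by
            simp; linarith [hbad h2 h4 u hu]
      · rcases lt_trichotomy (x 1) 0 with h1 | h1 | h1
        · exact go mF ![0, -1, -δ, -η] (by simp [Fin.forall_fin_succ, h1, h2, h3, hδ.le, hη.le, hζ.le]) fun u hu => by
            simp; linarith [((key u hu).2.2.2.1 ((px u hu 0).trans d0)).2.1]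
        · exact go mK ![0, η, -δ, -1] (by simp [Fin.forall_fin_succ, h2, h3, hδ.le, hη.le, hζ.le]) fun u hu => by
            simp; linarith [(key u hu).2.2.2.2.1 ((px u hu 0).trans d0) ((px u hu 1).trans d1) (Or.inr (pz 1 h1 u))]
        · exact go mK ![0, -η, -δ, -1] (by simp [Fin.forall_fin_succ, h1, h2, h3, hδ.le, hη.le, hζ.le]) fun u hu => by
            simp; linarith [((key u hu).2.2.2.1 ((px u hu 0).trans d0)).1]
    · rw [h3, abs_zero] at h4; linarith
    · rcases lt_trichotomy (x 2) 0 with h2 | h2 | h2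
      · rcases lt_trichotomy (x 1) 0 with h1 | h1 | h1
        · exact go mK' ![0, -η, -δ, -1] (by simp [Fin.forall_fin_succ, h1, h2, h3, hδ.le, hη.le, hζ.le]) fun u hu => by
            simp; linarith [((key u hu).2.2.2.1 ((px u hu 0).trans d0)).1]
        · exact go mK' ![0, η, -δ, -1] (by simp [Fin.forall_fin_succ, h2, h3, hδ.le, hη.le, hζ.le]) fun u hu => by
            simp; linarith [(key u hu).2.2.2.2.1 ((px u hu 0).trans d0) ((px u hu 1).trans d1) (Or.inr (pz 1 h1 u))]
        · exact go mF' ![0, -1, -δ, -η] (by simp [Fin.forall_fin_succ, h1, h2, h3, hδ.le, hη.le, hζ.le]) fun u hu => by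
            simp; linarith [((key u hu).2.2.2.1 ((px u hu 0).trans d0)).2.1]
      · rcases lt_trichotomy (x 1) 0 with h1 | h1 | h1
        · exact go mK' ![0, -η, δ, -1] (by simp [Fin.forall_fin_succ, h1, h3, hδ.le, hη.le, hζ.le]) fun u hu => by
            simp; linarith [hbad h2 h4 u hu]
        · exact go mE' ![0, η, δ, -1] (by simp [Fin.forall_fin_succ, h3, hδ.le, hη.le, hζ.le]) fun u hu => by
            simp; linarith [(key u hu).2.2.2.2.2 ((px u hu 0).trans d0) (pz 1 h1 u) (pz 2 h2 u)]
        · exact go mE' ![0, -η, δ, -1] (by simp [Fin.forall_fin_succ, h1, h3, hδ.le, hη.le, hζ.le]) fun u hu => by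
            simp; linarith [hbad h2 h4 u hu]
      · rcases lt_trichotomy (x 1) 0 with h1 | h1 | h1
        · rcases lt_trichotomy (x 0) 0 with h0 | h0 | h0
          · exact go mH' ![-δ, -η, -1, -ζ] (by simp [Fin.forall_fin_succ, h0, h1, h2, h3, hδ.le, hη.le, hζ.le]) fun u hu => by
              simp; linarith [((key u hu).2.2.2.1 ((px u hu 0).trans d0)).2.2]
          · exact go mE' ![0, η, -δ, -1] (by simp [Fin.forall_fin_succ, h2, h3, hδ.le, hη.le, hζ.le]) fun u hu => by
              simp; linarith [(key u hu).2.2.2.2.1 ((px u hu 0).trans d0) ((px u hu 1).trans d1) (Or.inl (pz 0 h0 u))]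
          · exact go mC' ![-δ, -η, -1, -ζ] (by simp [Fin.forall_fin_succ, h0, h1, h2, h3, hδ.le, hη.le, hζ.le]) fun u hu => by
              simp; linarith [((key u hu).2.2.2.1 ((px u hu 0).trans d0)).2.2]
        · exact go mE' ![0, η, -δ, -1] (by simp [Fin.forall_fin_succ, h2, h3, hδ.le, hη.le, hζ.le]) fun u hu => by
            simp; linarith [(key u hu).2.2.2.2.1 ((px u hu 0).trans d0) ((px u hu 1).trans d1) (Or.inr (pz 1 h1 u))]
        · exact go mE' ![0, -η, -δ, -1] (by simp [Fin.forall_fin_succ, h1, h2, h3, hδ.le, hη.le, hζ.le]) fun u hu => by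
            simp; linarith [((key u hu).2.2.2.1 ((px u hu 0).trans d0)).1]

/-- `u` is a normalised outer normal of `B` at `x`. -/
def IsNormalAt (B : Set (Fin 4 → ℝ)) (x u : Fin 4 → ℝ) : Prop :=
  (∀ y ∈ B, ∑ i, u i * y i ≤ 1) ∧ ∑ i, u i * x i = 1

theorem zero_mem_int {B : Set (Fin 4 → ℝ)} (hB : memU B) : (0 : Fin 4 → ℝ) ∈ interior B := by
  obtain ⟨⟨hc, hk, z, hz⟩, hu, -⟩ := hB
  have h1 : -z ∈ B := by
    have := hu z (interior_subset hz) (fun _ => -1) (fun _ => Or.inr rfl)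
    convert this using 1
    ext i; simp
  have := hc.combo_interior_self_mem_interior hz h1 (a := 1 / 2) (b := 1 / 2)
    (by norm_num) (by norm_num) (by norm_num)
  simpa using this

theorem illum_of_normals {B : Set (Fin 4 → ℝ)} (hB : memU B) {x d : Fin 4 → ℝ} (hx : x ∈ B)
    (h : ∀ u, IsNormalAt B x u → ∑ i, u i * d i < 0) : Illuminates B d x := by
  by_contra hcon
  have h0 := zero_mem_int hB
  obtain ⟨⟨hc, hk, hne⟩, hu, -⟩ := hB
  have hray : Convex ℝ ((fun t : ℝ => x + t • d) '' Set.Ioi 0) := by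
    rintro _ ⟨s, hs, rfl⟩ _ ⟨t, ht, rfl⟩ a b ha hb hab
    refine ⟨a * s + b * t, ?_, ?_⟩
    · exact (convex_Ioi (0 : ℝ)) hs ht ha hb hab
    · ext i
      simp only [Pi.add_apply, Pi.smul_apply, smul_eq_mul]
      linear_combination (-x i) * hab
  have hdisj : Disjoint (interior B) ((fun t : ℝ => x + t • d) '' Set.Ioi 0) := by
    rw [Set.disjoint_left]
    rintro _ hy ⟨t, ht, rfl⟩
    exact hcon ⟨t, ht, hy⟩
  obtain ⟨f, c, hf1, hf2⟩ := geometric_hahn_banach_open hc.interior isOpen_interior hray hdisj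
  have hc0 : 0 < c := by simpa using hf1 0 h0
  have hBc : ∀ y ∈ B, f y ≤ c := by
    intro y hy
    have hcl : y ∈ closure (interior B) := by
      rw [hc.closure_interior_eq_closure_of_nonempty_interior hne]
      exact subset_closure hy
    exact closure_minimal (fun z hz => (hf1 z hz).le) (isClosed_le f.continuous continuous_const) hcl
  have hray' : ∀ t : ℝ, 0 < t → c ≤ f x + t * f d := by
    intro t ht
    have := hf2 _ ⟨t, ht, rfl⟩
    simpa using this
  have hfx : f x = c := by
    apply le_antisymm (hBc x hx)
    by_contra hlt
    push Not at hlt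
    have hd : 0 < f d := by have := hray' 1 one_pos; linarith
    have := hray' ((c - f x) / (2 * f d)) (by apply div_pos <;> linarith)
    have e : (c - f x) / (2 * f d) * f d = (c - f x) / 2 := by field_simp
    linarith
  have hfd : 0 ≤ f d := by have := hray' 1 one_pos; linarith
  have hrep : ∀ y, f y = ∑ i, f (Pi.single i 1) * y i := by
    intro y
    conv_lhs => rw [← Finset.univ_sum_single y]
    rw [map_sum]
    refine Finset.sum_congr rfl fun i _ => ?_
    have : (Pi.single i (y i) : Fin 4 → ℝ) = y i • Pi.single i 1 := by
      rw [← Pi.single_smul]; simp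
    rw [this, map_smul, smul_eq_mul, mul_comm]
  have hsc : ∀ y, ∑ i, f (Pi.single i 1) / c * y i = f y / c := by
    intro y
    rw [hrep y, Finset.sum_div]
    exact Finset.sum_congr rfl fun i _ => by ring
  have := h (fun i => f (Pi.single i 1) / c) ⟨fun y hy => by
    rw [hsc, div_le_one hc0]; exact hBc y hy, by rw [hsc, hfx, div_self hc0.ne']⟩
  rw [hsc] at this
  have := div_nonneg hfd hc0.le
  linarith

theorem normal_abs {B : Set (Fin 4 → ℝ)} (hB : memU B) {x u : Fin 4 → ℝ}
    (hu : IsNormalAt B x u) : ∀ y ∈ B, ∑ i, |u i| * |y i| ≤ 1 := by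
  intro y hy
  have := hu.1 _ (hB.2.1 y hy (fun i => if 0 ≤ u i * y i then 1 else -1)
    (fun i => by split_ifs <;> simp))
  refine le_trans (le_of_eq (Finset.sum_congr rfl fun i _ => ?_)) this
  rw [← abs_mul]
  split_ifs with h
  · rw [abs_of_nonneg h]; ring
  · rw [abs_of_neg (not_le.mp h)]; ring

theorem stdB_mem {B : Set (Fin 4 → ℝ)} (hB : memU B) (i : Fin 4) : stdB i ∈ B :=
  hB.1.2.1.isClosed.frontier_subset (hB.2.2 i)

theorem normal_le_one {B : Set (Fin 4 → ℝ)} (hB : memU B) {x u : Fin 4 → ℝ}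
    (hu : IsNormalAt B x u) (i : Fin 4) : |u i| ≤ 1 := by
  have := normal_abs hB hu _ (stdB_mem hB i)
  have e : ∑ j, |u j| * |(stdB i : Fin 4 → ℝ) j| = |u i| := by
    rw [Finset.sum_eq_single i]
    · simp [stdB]
    · intro j _ hj; simp [stdB, hj]
    · simp
  linarith

theorem normal_sign {B : Set (Fin 4 → ℝ)} (hB : memU B) {x u : Fin 4 → ℝ} (hx : x ∈ B)
    (hu : IsNormalAt B x u) (i : Fin 4) : 0 ≤ u i * x i := by
  have h1 := normal_abs hB hu x hx
  have h2 : ∑ j, (|u j * x j| - u j * x j) ≤ 0 := by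
    rw [Finset.sum_sub_distrib, hu.2]
    simp only [abs_mul]; linarith
  have h3 := Finset.single_le_sum (f := fun j => |u j * x j| - u j * x j)
    (fun j _ => sub_nonneg.2 (le_abs_self _)) (Finset.mem_univ i)
  have h4 : |u i * x i| - u i * x i ≤ 0 := h3.trans h2
  linarith [abs_nonneg (u i * x i)]

theorem coord_le_one {B : Set (Fin 4 → ℝ)} (hB : memU B) {x : Fin 4 → ℝ} (hx : x ∈ B)
    (i : Fin 4) : |x i| ≤ 1 := by
  have hex : ∃ u, IsNormalAt B (stdB i) u := by
    by_contra hno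
    push Not at hno
    obtain ⟨t, ht, h⟩ := illum_of_normals hB (d := 0) (stdB_mem hB i)
      (fun u hu => absurd hu (hno u))
    have h2 := (hB.2.2 i).2
    simp at h
    exact h2 h
  obtain ⟨u, hu⟩ := hex
  have h1 : u i = 1 := by
    have := hu.2
    rw [Finset.sum_eq_single i] at this
    · simpa [stdB] using this
    · intro j _ hj; simp [stdB, hj]
    · simp
  have h2 := normal_abs hB hu x hx
  have h3 := Finset.single_le_sum (f := fun j => |u j| * |x j|)
    (fun j _ => by positivity) (Finset.mem_univ i)
  have h4 : |u i| * |x i| ≤ 1 := h3.trans h2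
  rw [h1] at h4
  simpa using h4

theorem update_mem {B : Set (Fin 4 → ℝ)} (hB : memU B) {x : Fin 4 → ℝ} (hx : x ∈ B)
    (i : Fin 4) {c : ℝ} (hc : |c| ≤ |x i|) : Function.update x i c ∈ B := by
  have hf := hB.2.1 x hx (fun j => if j = i then -1 else 1)
    (fun j => by split_ifs <;> simp)
  by_cases h0 : x i = 0
  · rw [h0, abs_zero] at hc
    have : c = x i := by rw [h0]; exact abs_nonpos_iff.1 hc
    rw [this, Function.update_eq_self]; exact hx
  · have hr : |c / x i| ≤ 1 := by
      rw [abs_div]; exact div_le_one_of_le₀ hc (abs_nonneg _)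
    obtain ⟨l, r⟩ := abs_le.1 hr
    have hcv : Convex ℝ B := hB.1.1
    have := hcv hx hf (a := (1 + c / x i) / 2) (b := (1 - c / x i) / 2)
      (by linarith) (by linarith) (by ring)
    convert this using 1
    ext j
    by_cases hj : j = i
    · subst hj; simp; field_simp; ring
    · simp [hj]; ring

theorem solid {B : Set (Fin 4 → ℝ)} (hB : memU B) {x y : Fin 4 → ℝ} (hx : x ∈ B)
    (h : ∀ i, |y i| ≤ |x i|) : y ∈ B := by
  have h0 := update_mem hB hx 0 (h 0)
  have h1 := update_mem hB h0 1 (c := y 1) (by simpa using h 1)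
  have h2 := update_mem hB h1 2 (c := y 2) (by simpa using h 2)
  have h3 := update_mem hB h2 3 (c := y 3) (by simpa using h 3)
  convert h3 using 1
  ext i
  fin_cases i <;> simp [Function.update]

theorem pair_gap {B : Set (Fin 4 → ℝ)} (hB : memU B) {i j : Fin 4} (hij : i ≠ j)
    (h : stdB i + stdB j ∉ B) :
    ∃ t : ℝ, 0 < t ∧ ∀ s, 0 < s → s ≤ t → ∀ x ∈ B, |x i| ≤ 1 - s ∨ |x j| ≤ 1 - s := by
  have hcl : IsClosed ((fun s : ℝ => (1 - s) • (stdB i + stdB j : Fin 4 → ℝ)) ⁻¹' B) :=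
    hB.1.2.1.isClosed.preimage (by fun_prop)
  have hn : ((fun s : ℝ => (1 - s) • (stdB i + stdB j : Fin 4 → ℝ)) ⁻¹' B)ᶜ ∈ nhds (0 : ℝ) :=
    hcl.isOpen_compl.mem_nhds (by simpa using h)
  obtain ⟨r, hr, hball⟩ := Metric.mem_nhds_iff.1 hn
  refine ⟨min (r / 2) 1, by positivity, fun s hs hst x hx => ?_⟩
  by_contra hcon
  push Not at hcon
  have hs1 : s ≤ 1 := hst.trans (min_le_right _ _)
  have hs2 : s ≤ r / 2 := hst.trans (min_le_left _ _)
  have hmem : s ∈ Metric.ball (0 : ℝ) r := by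
    rw [Metric.mem_ball, Real.dist_eq, sub_zero, abs_of_pos hs]; linarith
  refine hball hmem (solid hB hx fun k => ?_)
  have e : |1 - s| = 1 - s := abs_of_nonneg (by linarith)
  by_cases hki : k = i
  · subst hki
    simp [stdB, hij, e, hcon.1.le]
  · by_cases hkj : k = j
    · subst hkj
      simp [stdB, hki, e, hcon.2.le]
    · simp [stdB, hki, hkj]

theorem exists_gap {B : Set (Fin 4 → ℝ)} (hB : memU B)
    (hpairs : ∀ i j : Fin 4, i ≠ j → stdB i + stdB j ∉ B) :
    ∃ m : ℝ, 0 < m ∧ m ≤ 1 / 2 ∧ ∀ x ∈ B, ∀ i j : Fin 4, i ≠ j →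
      |x i| ≤ 1 - 2 * m ∨ |x j| ≤ 1 - 2 * m := by
  have h : ∀ q : Fin 4 × Fin 4, ∃ t : ℝ, 0 < t ∧ ∀ s, 0 < s → s ≤ t → q.1 ≠ q.2 → ∀ x ∈ B,
      |x q.1| ≤ 1 - s ∨ |x q.2| ≤ 1 - s := by
    intro q
    by_cases hq : q.1 = q.2
    · exact ⟨1, one_pos, fun s _ _ h => absurd hq h⟩
    · obtain ⟨t, ht, h⟩ := pair_gap hB hq (hpairs _ _ hq)
      exact ⟨t, ht, fun s hs hst _ => h s hs hst⟩
  choose t ht htp using h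
  obtain ⟨q0, -, hq0⟩ := Finset.exists_min_image Finset.univ t ⟨(0, 0), Finset.mem_univ _⟩
  have hm0 : 0 < min (t q0 / 2) (1 / 2) := by have := ht q0; positivity
  refine ⟨min (t q0 / 2) (1 / 2), hm0, min_le_right _ _, fun x hx i j hij => ?_⟩
  refine htp (i, j) _ (by linarith) ?_ hij x hx
  have := hq0 (i, j) (Finset.mem_univ _)
  linarith [min_le_left (t q0 / 2) (1 / 2)]

/-- The two exceptional configurations exclude each other. -/
theorem excl {m δ X0 X1 X3 Y0 Y1 Y3 U0 U1 U3 V0 V1 V3 : ℝ} (hm : 0 < m) (hm1 : m ≤ 1 / 2)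
    (hδ : 0 < δ) (hδm : 2 * δ < m * m)
    (hX0 : 0 ≤ X0) (hX1 : 0 ≤ X1) (hX0' : X0 ≤ 1 - 2 * m) (hX1' : X1 ≤ 1 - 2 * m)
    (hX3 : 1 - m < X3) (hX3' : X3 ≤ 1)
    (hY3 : 0 ≤ Y3) (hY1 : 0 ≤ Y1) (hY3' : Y3 ≤ 1 - 2 * m) (hY1' : Y1 ≤ 1 - 2 * m)
    (hY0 : 1 - m < Y0) (hY0' : Y0 ≤ 1)
    (hU0 : 0 ≤ U0) (hU1 : 0 ≤ U1) (hU1' : U1 ≤ 1) (hU3 : 0 ≤ U3) (hU3' : U3 ≤ δ)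
    (hV3 : 0 ≤ V3) (hV1 : 0 ≤ V1) (hV1' : V1 ≤ 1) (hV0 : 0 ≤ V0) (hV0' : V0 ≤ δ)
    (e1 : U0 * X0 + U1 * X1 + U3 * X3 = 1) (l1 : U0 * Y0 + U1 * Y1 + U3 * Y3 ≤ 1)
    (e2 : V0 * Y0 + V1 * Y1 + V3 * Y3 = 1) (l2 : V0 * X0 + V1 * X1 + V3 * X3 ≤ 1) : False := by
  have a1 : U1 * X1 ≤ X1 := mul_le_of_le_one_left hX1 hU1'
  have a2 : U3 * X3 ≤ U3 := mul_le_of_le_one_right hU3 hX3'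
  have a3 : U0 * X0 ≤ U0 := mul_le_of_le_one_right hU0 (by linarith)
  have a4 : m ≤ U0 := by nlinarith
  have a5 : m * m ≤ U0 * (Y0 - X0) := mul_le_mul a4 (by linarith) hm.le hU0
  have a6 : 0 ≤ U3 * Y3 := by positivity
  have a7 : 0 < U1 * (X1 - Y1) := by nlinarith
  have b1 : V1 * Y1 ≤ Y1 := mul_le_of_le_one_left hY1 hV1'
  have b2 : V0 * Y0 ≤ V0 := mul_le_of_le_one_right hV0 hY0'
  have b3 : V3 * Y3 ≤ V3 := mul_le_of_le_one_right hV3 (by linarith)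
  have b4 : m ≤ V3 := by nlinarith
  have b5 : m * m ≤ V3 * (X3 - Y3) := mul_le_mul b4 (by linarith) hm.le hV3
  have b6 : 0 ≤ V0 * X0 := by positivity
  have b7 : 0 < V1 * (Y1 - X1) := by nlinarith
  have c1 := pos_of_mul_pos_right a7 hU1
  have c2 := pos_of_mul_pos_right b7 hV1
  linarith

theorem illumNumber_le (B : Set (Fin 4 → ℝ)) (δ η ζ : ℝ) (hδ : 0 < δ) (hη : 0 < η) (σ : Equiv.Perm (Fin 4))
    (h : IlluminatesSet B ((fun d => d ∘ σ) '' dirs δ η ζ)) : illumNumber B ≤ 14 := by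
  classical
  set L : List (Fin 4 → ℝ) := [![1, δ, η, 0], -![1, δ, η, 0],
            ![δ, -1, -η, 0], -![δ, -1, -η, 0],
            ![δ, -η, 1, ζ], -![δ, -η, 1, ζ],
            ![-δ, -η, 1, ζ], -![-δ, -η, 1, ζ],
            ![0, η, δ, 1], -![0, η, δ, 1],
            ![0, -η, -δ, 1], -![0, -η, -δ, 1],
            ![0, 1, -δ, η], -![0, 1, -δ, η]] with hL
  have hLd : ∀ d, d ∈ L ↔ d ∈ dirs δ η ζ := by
    intro d
    simp only [hL, dirs, List.mem_cons, List.not_mem_nil, or_false, Set.mem_insert_iff,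
      Set.mem_singleton_iff]
  have hD : (((L.map (fun d => d ∘ σ)).toFinset : Finset (Fin 4 → ℝ)) : Set (Fin 4 → ℝ)) =
      (fun d => d ∘ σ) '' dirs δ η ζ := by
    ext d
    simp only [List.coe_toFinset, List.mem_map, Set.mem_ofPred_eq, Set.mem_image, hLd]
  have hn : ∀ d ∈ dirs δ η ζ, d 1 ≠ 0 := by
    intro d hd
    simp only [dirs, Set.mem_insert_iff, Set.mem_singleton_iff] at hd
    rcases hd with h | h | h | h | h | h | h | h | h | h | h | h | h | h <;>
      simp [h, hδ.ne', hη.ne']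
  have hcard : (L.map (fun d => d ∘ σ)).toFinset.card ≤ 14 := by
    refine (List.toFinset_card_le _).trans ?_
    simp [hL]
  refine le_trans (Nat.sInf_le ⟨(L.map (fun d => d ∘ σ)).toFinset, rfl, ?_, ?_⟩) hcard
  · intro d hd h0
    have hd' : d ∈ (fun d => d ∘ σ) '' dirs δ η ζ := by rw [← hD]; exact hd
    obtain ⟨d', hd', rfl⟩ := hd'
    apply hn d' hd'
    have := congrFun h0 (σ.symm 1)
    simpa using this
  · rw [hD]; exact h

/-- If `B ∈ 𝒰⁴` contains no point `e_i + e_j` (`i ≠ j`), then for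
some `0 < ζ < η < δ < 1` and some coordinate permutation `σ`, the permuted
14-element set `{±(1,δ,η,0), ±(δ,-1,-η,0), ±(δ,-η,1,ζ), ±(-δ,-η,1,ζ),
±(0,η,δ,1), ±(0,-η,-δ,1), ±(0,1,-δ,η)}` illuminates `B`; in particular
`𝕀(B) ≤ 14 = 2⁴ - 2`. -/
theorem stmt18 (B : Set (Fin 4 → ℝ)) (hB : memU B)
    (hpairs : ∀ i j : Fin 4, i ≠ j → stdB i + stdB j ∉ B) :
    ∃ δ η ζ : ℝ, 0 < ζ ∧ ζ < η ∧ η < δ ∧ δ < 1 ∧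
      ∃ σ : Equiv.Perm (Fin 4),
        IlluminatesSet B ((fun d => d ∘ σ) ''
          ({![1, δ, η, 0], -![1, δ, η, 0],
            ![δ, -1, -η, 0], -![δ, -1, -η, 0],
            ![δ, -η, 1, ζ], -![δ, -η, 1, ζ],
            ![-δ, -η, 1, ζ], -![-δ, -η, 1, ζ],
            ![0, η, δ, 1], -![0, η, δ, 1],
            ![0, -η, -δ, 1], -![0, -η, -δ, 1],
            ![0, 1, -δ, η], -![0, 1, -δ, η]} : Set (Fin 4 → ℝ))) ∧
        illumNumber B ≤ 14 := by
  obtain ⟨m, hm, hm1, hgap⟩ := exists_gap hB hpairs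
  obtain ⟨δ, hδ⟩ : ∃ δ, δ = m * m / 4 := ⟨_, rfl⟩
  obtain ⟨η, hη⟩ : ∃ η, η = δ * m / 4 := ⟨_, rfl⟩
  obtain ⟨ζ, hζ⟩ : ∃ ζ, ζ = η * m / 2 := ⟨_, rfl⟩
  have hδ0 : 0 < δ := by rw [hδ]; positivity
  have hη0 : 0 < η := by rw [hη]; positivity
  have hζ0 : 0 < ζ := by rw [hζ]; positivity
  have hmm : m * m ≤ m / 2 := by nlinarith
  have hδm : δ * m ≤ δ / 2 := by nlinarith
  have hηm : η * m ≤ η / 2 := by nlinarith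
  have hδm0 : 0 < δ * m := by positivity
  have hηm0 : 0 < η * m := by positivity
  suffices hs : ∃ σ : Equiv.Perm (Fin 4), IlluminatesSet B ((fun d => d ∘ σ) '' dirs δ η ζ) by
    obtain ⟨σ, hσ⟩ := hs
    exact ⟨δ, η, ζ, hζ0, by linarith, by linarith, by linarith, σ, hσ,
      illumNumber_le B δ η ζ hδ0 hη0 σ hσ⟩
  have hmain := core δ η ζ m hm hζ0 (by linarith) (by linarith) (by linarith) hm1
  have hfr : ∀ x ∈ frontier B, x ∈ B := fun x hx => hB.1.2.1.isClosed.frontier_subset hx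
  by_cases hbad : ∃ x ∈ B, ∃ u, IsNormalAt B x u ∧ x 2 = 0 ∧ 1 - m < |x 3| ∧
      η * |u 1| + |u 3| ≤ δ * |u 2|
  · refine ⟨Equiv.swap 0 3, fun y hy => ?_⟩
    have hyB := hfr y hy
    have s0 : Equiv.swap (0 : Fin 4) 3 0 = 3 := by decide
    have s1 : Equiv.swap (0 : Fin 4) 3 1 = 1 := by decide
    have s2 : Equiv.swap (0 : Fin 4) 3 2 = 2 := by decide
    have s3 : Equiv.swap (0 : Fin 4) 3 3 = 0 := by decide
    have hstep := hmain (y ∘ Equiv.swap 0 3)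
      (fun u => IsNormalAt B y (u ∘ Equiv.swap 0 3)) (fun i => coord_le_one hB hyB _)
      (fun i j hij => hgap y hyB _ _ ((Equiv.injective _).ne hij))
    have hstep2 := hstep (by
      intro u hu
      refine ⟨fun i => ?_, fun i => ?_, ?_⟩
      · have := normal_le_one hB hu (Equiv.swap 0 3 i)
        simpa using this
      · have := normal_sign hB hyB hu (Equiv.swap 0 3 i)
        simpa using this
      · have := hu.2
        simp only [Fin.sum_univ_four, Function.comp_apply, s0, s1, s2, s3] at this ⊢
        linarith)
    obtain ⟨d, hd, hd'⟩ := hstep2 (by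
      intro hy2 hy0 v hv
      obtain ⟨x, hx, u, hu, hx2, hx3, hub⟩ := hbad
      simp only [Function.comp_apply, s2, s3] at hy2 hy0
      by_contra hcon
      push Not at hcon
      have hv0 := normal_le_one hB hv 0
      have hv1 := normal_le_one hB hv 1
      have hv2 := normal_le_one hB hv 2
      have hvX := normal_abs hB hv x hx
      have hvY := normal_abs hB hv y hyB
      have hvE := hv.2
      have hvS := normal_sign hB hyB hv
      have hu1 := normal_le_one hB hu 1
      have hu2 := normal_le_one hB hu 2
      have huY := normal_abs hB hu y hyB
      have huE := hu.2
      have huS := normal_sign hB hx hu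
      have huE' : ∑ i, |u i| * |x i| = 1 := by
        rw [← huE]
        exact Finset.sum_congr rfl fun i _ => by rw [← abs_mul, abs_of_nonneg (huS i)]
      have hvE' : ∑ i, |(v ∘ Equiv.swap 0 3) i| * |y i| = 1 := by
        rw [← hvE]
        exact Finset.sum_congr rfl fun i _ => by rw [← abs_mul, abs_of_nonneg (hvS i)]
      simp only [Fin.sum_univ_four, Function.comp_apply, s0, s1, s2, s3, hx2, hy2, abs_zero,
        mul_zero, add_zero] at hv0 hv1 hv2 hvX huY huE' hvE'
      have n1 := abs_nonneg (u 1)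
      have n2 := abs_nonneg (v 1)
      have p1 : 0 ≤ η * |u 1| := by positivity
      have p2 : 0 ≤ η * |v 1| := by positivity
      have q1 : δ * |u 2| ≤ δ := mul_le_of_le_one_right hδ0.le hu2
      have q2 : δ * |v 2| ≤ δ := mul_le_of_le_one_right hδ0.le hv2
      have p3 : 0 ≤ |u 2| * |y 2| := by positivity
      exact excl (U0 := |u 0|) (U1 := |u 1|) (U3 := |u 3|) (V0 := |v 3|) (V1 := |v 1|)
        (V3 := |v 0|) hm hm1 hδ0 (by rw [hδ]; nlinarith) (abs_nonneg (x 0)) (abs_nonneg (x 1))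
        ((hgap x hx 0 3 (by decide)).resolve_right (by linarith))
        ((hgap x hx 1 3 (by decide)).resolve_right (by linarith)) hx3 (coord_le_one hB hx 3)
        (abs_nonneg (y 3)) (abs_nonneg (y 1))
        ((hgap y hyB 3 0 (by decide)).resolve_right (by linarith))
        ((hgap y hyB 1 0 (by decide)).resolve_right (by linarith)) hy0 (coord_le_one hB hyB 0)
        (abs_nonneg _) n1 hu1 (abs_nonneg _) (by linarith)
        (abs_nonneg _) n2 hv1 (abs_nonneg _) (by linarith)
        huE' (by simpa [hy2] using huY) hvE' hvX)
    refine ⟨_, ⟨d, hd, rfl⟩, illum_of_normals hB hyB fun u hu => ?_⟩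
    have h1 := hd' (u ∘ Equiv.swap 0 3) (by
      convert hu using 1
      ext i; simp)
    simp only [Fin.sum_univ_four, Function.comp_apply, s0, s1, s2, s3] at h1 ⊢
    linarith
  · push Not at hbad
    refine ⟨1, fun y hy => ?_⟩
    have hyB := hfr y hy
    obtain ⟨d, hd, hd'⟩ := hmain y (IsNormalAt B y) (fun i => coord_le_one hB hyB i)
      (fun i j hij => hgap y hyB i j hij)
      (fun u hu => ⟨fun i => normal_le_one hB hu i, fun i => normal_sign hB hyB hu i, by
        have := hu.2
        rwa [Fin.sum_univ_four] at this⟩)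
      (fun h2 h3 u hu => hbad y hyB u hu h2 h3)
    refine ⟨_, ⟨d, hd, rfl⟩, illum_of_normals hB hyB fun u hu => ?_⟩
    have h1 := hd' u hu
    simpa [Fin.sum_univ_four] using h1
end

section
/- Let B ∈ 𝒰⁴ not be a parallelepiped, and suppose that exactly four of the six unordered pairs {i,j} of distinct indices in {1,2,3,4} satisfy e_i + e_j ∈ B, while no point of the form e_{j₁} + e_{j₂} + e_{j₃} with j₁, j₂, j₃ distinct belongs to B. Then there exist a permutation σ of the coordinates {1,2,3,4} and real numbers 0 < η < δ < 1 such that the set obtained by applying σ to at least one of the following two sets illuminates B: the 14-element set F₁ = {±(1,δ,η,0), ±(δ,−1,−η,0), ±(δ,−η,1,0), ±(δ,η,−1,0), ±(0,η,δ,1), ±(0,−η,−δ,1), ±(0,1,−1,0)}, or the 12-element set F₂ = {±(1,−η,−δ,−δ), ±(−η,1,−δ,−δ), ±(δ,0,1,−η), ±(δ,0,−η,1), ±(0,δ,1,−η), ±(0,δ,−η,1)}. In particular 𝕀(B) ≤ 14 = 2⁴ − 2. -/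
open Set

namespace St19

/-- `d` illuminates `x`, in quantitative form. -/
def lit (B : Set (Fin 4 → ℝ)) (d x : Fin 4 → ℝ) : Prop :=
  ∃ ε : ℝ, 0 < ε ∧ ∃ z ∈ B, ∀ i, |x i + ε * d i| < z i

/-- Working properties of the body. -/
structure Good (B : Set (Fin 4 → ℝ)) : Prop where
  conv : Convex ℝ B
  closed : IsClosed B
  solid : ∀ x ∈ B, ∀ y : Fin 4 → ℝ, (∀ i, |y i| ≤ |x i|) → y ∈ B
  basis : ∀ i, stdB i ∈ B
  le_one : ∀ x ∈ B, ∀ i, |x i| ≤ 1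

/-- `v` lies in `C • B`. -/
def InC (B : Set (Fin 4 → ℝ)) (C : ℝ) (v : Fin 4 → ℝ) : Prop :=
  0 ≤ C ∧ ∃ q ∈ B, v = C • q

lemma InC.of_mem {B : Set (Fin 4 → ℝ)} {q : Fin 4 → ℝ} (hq : q ∈ B) {c : ℝ} (hc : 0 ≤ c) :
    InC B c (c • q) := ⟨hc, q, hq, rfl⟩

lemma InC.plus {B : Set (Fin 4 → ℝ)} (hB : Convex ℝ B) {c c' : ℝ} {v v' : Fin 4 → ℝ}
    (h : InC B c v) (h' : InC B c' v') : InC B (c + c') (v + v') := by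
  obtain ⟨hc, q, hq, rfl⟩ := h
  obtain ⟨hc', q', hq', rfl⟩ := h'
  refine ⟨by positivity, ?_⟩
  rcases eq_or_lt_of_le (add_nonneg hc hc') with h0 | h0
  · have h1 : c = 0 := by linarith
    have h2 : c' = 0 := by linarith
    exact ⟨q, hq, by simp [h1, h2]⟩
  · refine ⟨(c / (c + c')) • q + (c' / (c + c')) • q', ?_, ?_⟩
    · apply hB hq hq' (by positivity) (by positivity)
      field_simp
    · ext i
      simp
      field_simp

lemma InC.plus4 {B : Set (Fin 4 → ℝ)} (hB : Good B) {c c' a0 a1 a2 a3 b0 b1 b2 b3 : ℝ}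
    (h : InC B c ![a0, a1, a2, a3]) (h' : InC B c' ![b0, b1, b2, b3]) :
    InC B (c + c') ![a0 + b0, a1 + b1, a2 + b2, a3 + b3] := by
  have := InC.plus hB.conv h h'
  convert this using 1
  ext i; fin_cases i <;> simp

lemma InC.E0 {B : Set (Fin 4 → ℝ)} (hB : Good B) {c : ℝ} (hc : 0 ≤ c) :
    InC B c ![c, 0, 0, 0] := by
  convert InC.of_mem (hB.basis 0) hc using 1
  ext i; fin_cases i <;> simp [stdB]

lemma InC.E1 {B : Set (Fin 4 → ℝ)} (hB : Good B) {c : ℝ} (hc : 0 ≤ c) :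
    InC B c ![0, c, 0, 0] := by
  convert InC.of_mem (hB.basis 1) hc using 1
  ext i; fin_cases i <;> simp [stdB]

lemma InC.E2 {B : Set (Fin 4 → ℝ)} (hB : Good B) {c : ℝ} (hc : 0 ≤ c) :
    InC B c ![0, 0, c, 0] := by
  convert InC.of_mem (hB.basis 2) hc using 1
  ext i; fin_cases i <;> simp [stdB]

lemma InC.E3 {B : Set (Fin 4 → ℝ)} (hB : Good B) {c : ℝ} (hc : 0 ≤ c) :
    InC B c ![0, 0, 0, c] := by
  convert InC.of_mem (hB.basis 3) hc using 1
  ext i; fin_cases i <;> simp [stdB]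

lemma InC.E01 {B : Set (Fin 4 → ℝ)} (h : stdB 0 + stdB 1 ∈ B) {c : ℝ} (hc : 0 ≤ c) :
    InC B c ![c, c, 0, 0] := by
  convert InC.of_mem h hc using 1
  ext i; fin_cases i <;> simp [stdB]

lemma InC.E02 {B : Set (Fin 4 → ℝ)} (h : stdB 0 + stdB 2 ∈ B) {c : ℝ} (hc : 0 ≤ c) :
    InC B c ![c, 0, c, 0] := by
  convert InC.of_mem h hc using 1
  ext i; fin_cases i <;> simp [stdB]

lemma InC.E03 {B : Set (Fin 4 → ℝ)} (h : stdB 0 + stdB 3 ∈ B) {c : ℝ} (hc : 0 ≤ c) :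
    InC B c ![c, 0, 0, c] := by
  convert InC.of_mem h hc using 1
  ext i; fin_cases i <;> simp [stdB]

lemma InC.E12 {B : Set (Fin 4 → ℝ)} (h : stdB 1 + stdB 2 ∈ B) {c : ℝ} (hc : 0 ≤ c) :
    InC B c ![0, c, c, 0] := by
  convert InC.of_mem h hc using 1
  ext i; fin_cases i <;> simp [stdB]

lemma InC.E13 {B : Set (Fin 4 → ℝ)} (h : stdB 1 + stdB 3 ∈ B) {c : ℝ} (hc : 0 ≤ c) :
    InC B c ![0, c, 0, c] := by
  convert InC.of_mem h hc using 1
  ext i; fin_cases i <;> simp [stdB]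

lemma InC.E23 {B : Set (Fin 4 → ℝ)} (h : stdB 2 + stdB 3 ∈ B) {c : ℝ} (hc : 0 ≤ c) :
    InC B c ![0, 0, c, c] := by
  convert InC.of_mem h hc using 1
  ext i; fin_cases i <;> simp [stdB]

lemma InC.P {B : Set (Fin 4 → ℝ)} {a b : ℝ} (h : ![0, 0, a, b] ∈ B) {c : ℝ} (hc : 0 ≤ c) :
    InC B c ![0, 0, c * a, c * b] := by
  convert InC.of_mem h hc using 1
  ext i; fin_cases i <;> simp

/-- The one-coordinate condition. -/
def Cd (x d v C : ℝ) : Prop :=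
  (0 < x ∧ d < v - C * x) ∨ (x < 0 ∧ -d < v + C * x) ∨ |d| < v - C * |x|

lemma Cd.pos {x d v C : ℝ} (hx : 0 < x) (hx1 : |x| ≤ 1) (hC : 0 ≤ C) (h : d < v - C) :
    Cd x d v C := by
  have := abs_le.1 hx1
  left
  refine ⟨hx, ?_⟩
  nlinarith

lemma Cd.neg {x d v C : ℝ} (hx : x < 0) (hx1 : |x| ≤ 1) (hC : 0 ≤ C) (h : -d < v - C) :
    Cd x d v C := by
  have := abs_le.1 hx1
  right; left
  refine ⟨hx, ?_⟩
  nlinarith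

lemma Cd.zero {x d v C : ℝ} (hx : x = 0) (h1 : d < v) (h2 : -d < v) : Cd x d v C := by
  right; right
  subst hx
  simpa using abs_lt.2 ⟨by linarith, h1⟩

lemma Cd.fill {x d v C θ : ℝ} (hx : |x| ≤ 1 - θ) (hC : 0 ≤ C) (h1 : d < v - C * (1 - θ))
    (h2 : -d < v - C * (1 - θ)) : Cd x d v C := by
  right; right
  have : C * |x| ≤ C * (1 - θ) := mul_le_mul_of_nonneg_left hx hC
  exact abs_lt.2 ⟨by linarith, by linarith⟩

lemma Cd.eventually {x d v C : ℝ} (h : Cd x d v C) :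
    ∀ᶠ ε in nhdsWithin (0 : ℝ) (Ioi 0), |x + ε * d| < (1 - ε * C) * |x| + ε * v := by
  have hp : ∀ᶠ ε in nhdsWithin (0 : ℝ) (Ioi 0), 0 < ε := self_mem_nhdsWithin
  have key : x ≠ 0 → ∀ᶠ ε in nhdsWithin (0 : ℝ) (Ioi 0), ε * |d| < |x| := by
    intro hx
    have hx' : 0 < |x| := abs_pos.2 hx
    have hpos : 0 < |x| / (|d| + 1) := by positivity
    filter_upwards [Ioo_mem_nhdsGT hpos] with ε hε
    have h1 := hε.2
    rw [lt_div_iff₀ (by positivity)] at h1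
    nlinarith [hε.1]
  rcases h with ⟨hx, h⟩ | ⟨hx, h⟩ | h
  · filter_upwards [hp, key hx.ne'] with ε h0 h1
    rw [abs_of_pos hx] at *
    have h2 : |ε * d| < x := by rwa [abs_mul, abs_of_pos h0]
    have h3 := abs_lt.1 h2
    rw [abs_of_pos (by linarith)]
    nlinarith
  · filter_upwards [hp, key hx.ne] with ε h0 h1
    rw [abs_of_neg hx] at *
    have h2 : |ε * d| < -x := by rwa [abs_mul, abs_of_pos h0]
    have h3 := abs_lt.1 h2
    rw [abs_of_neg (by linarith)]
    nlinarith
  · filter_upwards [hp] with ε h0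
    have h1 := abs_add_le x (ε * d)
    rw [abs_mul, abs_of_pos h0] at h1
    nlinarith

lemma lit_of {B : Set (Fin 4 → ℝ)} (hB : Good B) {x d v : Fin 4 → ℝ} {C : ℝ} (hx : x ∈ B)
    (hv : InC B C v) (h : ∀ i, Cd (x i) (d i) (v i) C) : lit B d x := by
  obtain ⟨hC, q, hq, rfl⟩ := hv
  have h1 : ∀ᶠ ε in nhdsWithin (0 : ℝ) (Ioi 0), ∀ i,
      |x i + ε * d i| < (1 - ε * C) * |x i| + ε * (C • q) i :=
    Filter.eventually_all.2 fun i => (h i).eventually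
  have h2 : ∀ᶠ ε in nhdsWithin (0 : ℝ) (Ioi 0), 0 < ε ∧ ε * C ≤ 1 := by
    have hpos : 0 < 1 / (C + 1) := by positivity
    filter_upwards [Ioo_mem_nhdsGT hpos] with ε hε
    have h1 := hε.2
    rw [lt_div_iff₀ (by positivity)] at h1
    exact ⟨hε.1, by nlinarith [hε.1]⟩
  obtain ⟨ε, h3, h4, h5⟩ := (h1.and h2).exists
  have hax : (fun i => |x i|) ∈ B := hB.solid x hx _ (fun i => by simp)
  refine ⟨ε, h4, (1 - ε * C) • (fun i => |x i|) + (ε * C) • q,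
    hB.conv hax hq (by linarith) (by positivity) (by ring), ?_⟩
  intro i
  have := h3 i
  simp only [Pi.add_apply, Pi.smul_apply, smul_eq_mul] at this ⊢
  linarith

lemma lit4 {B : Set (Fin 4 → ℝ)} (hB : Good B) {D : Set (Fin 4 → ℝ)} {x : Fin 4 → ℝ}
    (hx : x ∈ B) {d0 d1 d2 d3 v0 v1 v2 v3 C : ℝ} (hD : ![d0, d1, d2, d3] ∈ D)
    (hv : InC B C ![v0, v1, v2, v3]) (h0 : 0 ≤ C → Cd (x 0) d0 v0 C)
    (h1 : 0 ≤ C → Cd (x 1) d1 v1 C)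
    (h2 : 0 ≤ C → Cd (x 2) d2 v2 C) (h3 : 0 ≤ C → Cd (x 3) d3 v3 C) :
    ∃ d ∈ D, lit B d x := by
  refine ⟨_, hD, lit_of hB hx hv ?_⟩
  intro i
  fin_cases i
  · exact h0 hv.1
  · exact h1 hv.1
  · exact h2 hv.1
  · exact h3 hv.1

lemma lit_neg {B : Set (Fin 4 → ℝ)} {d x : Fin 4 → ℝ} (h : lit B d (-x)) : lit B (-d) x := by
  obtain ⟨ε, h0, z, hz, h⟩ := h
  refine ⟨ε, h0, z, hz, fun i => ?_⟩
  have := h i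
  rw [← abs_neg]
  convert this using 2
  simp; ring

/-- The first family. -/
def F1 (δ η : ℝ) : Set (Fin 4 → ℝ) :=
  {![1, δ, η, 0], -![1, δ, η, 0],
            ![δ, -1, -η, 0], -![δ, -1, -η, 0],
            ![δ, -η, 1, 0], -![δ, -η, 1, 0],
            ![δ, η, -1, 0], -![δ, η, -1, 0],
            ![0, η, δ, 1], -![0, η, δ, 1],
            ![0, -η, -δ, 1], -![0, -η, -δ, 1],
            ![0, 1, -1, 0], -![0, 1, -1, 0]}

/-- The second family. -/
def F2 (δ η : ℝ) : Set (Fin 4 → ℝ) :=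
  {![1, -η, -δ, -δ], -![1, -η, -δ, -δ],
            ![-η, 1, -δ, -δ], -![-η, 1, -δ, -δ],
            ![δ, 0, 1, -η], -![δ, 0, 1, -η],
            ![δ, 0, -η, 1], -![δ, 0, -η, 1],
            ![0, δ, 1, -η], -![0, δ, 1, -η],
            ![0, δ, -η, 1], -![0, δ, -η, 1]}

lemma F1_neg {δ η : ℝ} {d : Fin 4 → ℝ} (h : d ∈ F1 δ η) : -d ∈ F1 δ η := by
  simp only [F1, mem_insert_iff, mem_singleton_iff] at h ⊢
  rcases h with rfl | rfl | rfl | rfl | rfl | rfl | rfl | rfl | rfl | rfl | rfl | rfl | rfl | rfl <;>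
    simp only [neg_neg, true_or, or_true]

lemma F2_neg {δ η : ℝ} {d : Fin 4 → ℝ} (h : d ∈ F2 δ η) : -d ∈ F2 δ η := by
  simp only [F2, mem_insert_iff, mem_singleton_iff] at h ⊢
  rcases h with rfl | rfl | rfl | rfl | rfl | rfl | rfl | rfl | rfl | rfl | rfl | rfl <;>
    simp only [neg_neg, true_or, or_true]

lemma neg_mem {B : Set (Fin 4 → ℝ)} (hB : Good B) {x : Fin 4 → ℝ} (hx : x ∈ B) : -x ∈ B :=
  hB.solid x hx _ (fun i => by simp)

/-- `D` lights every point of `B`. -/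
def LS (B D : Set (Fin 4 → ℝ)) : Prop := ∀ x ∈ B, ∃ d ∈ D, lit B d x

lemma F1_A {B : Set (Fin 4 → ℝ)} (hB : Good B) (h01 : stdB 0 + stdB 1 ∈ B)
    {θ δ η : ℝ} (h0 : 0 < θ) (h1 : θ < 1) (hδ : θ = 100 * δ) (hη : θ * δ = 100 * η)
    {x : Fin 4 → ℝ} (hx : x ∈ B) (hx0 : |x 0| ≤ 1 - θ) (hx1 : |x 1| ≤ 1 - θ) (hx3 : 0 < x 3) :
    ∃ d ∈ F1 δ η, lit B d x := by
  have hδ0 : 0 < δ := by linarith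
  have hη0 : 0 < η := by nlinarith [mul_pos h0 hδ0]
  have hle := hB.le_one x hx
  rcases lt_trichotomy (x 2) 0 with h2 | h2 | h2
  · refine lit4 hB hx (d0 := 0) (d1 := η) (d2 := δ) (d3 := -1) (by simp [F1])
      (InC.E01 h01 (c := δ / 2) (by positivity))
      (fun hC => .fill hx0 hC ?_ ?_) (fun hC => .fill hx1 hC ?_ ?_)
      (fun hC => .neg h2 (hle 2) hC ?_) (fun hC => .pos hx3 (hle 3) hC ?_) <;>
    nlinarith
  · refine lit4 hB hx (d0 := 0) (d1 := η) (d2 := δ) (d3 := -1) (by simp [F1])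
      (InC.plus4 hB (InC.E2 hB (c := 2 * δ) (by positivity)) (InC.E01 h01 (c := 1 / 2) (by positivity)))
      (fun hC => .fill hx0 hC ?_ ?_) (fun hC => .fill hx1 hC ?_ ?_)
      (fun hC => .zero h2 ?_ ?_) (fun hC => .pos hx3 (hle 3) hC ?_) <;>
    nlinarith
  · refine lit4 hB hx (d0 := 0) (d1 := -η) (d2 := -δ) (d3 := -1) (by simp [F1])
      (InC.E01 h01 (c := δ / 2) (by positivity))
      (fun hC => .fill hx0 hC ?_ ?_) (fun hC => .fill hx1 hC ?_ ?_)
      (fun hC => .pos h2 (hle 2) hC ?_) (fun hC => .pos hx3 (hle 3) hC ?_) <;>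
    nlinarith

set_option maxHeartbeats 4000000 in
lemma F1_B {B : Set (Fin 4 → ℝ)} (hB : Good B) (h02 : stdB 0 + stdB 2 ∈ B)
    (h23 : stdB 2 + stdB 3 ∈ B)
    {θ δ η : ℝ} (h0 : 0 < θ) (h1 : θ < 1) (hδ : θ = 100 * δ) (hη : θ * δ = 100 * η)
    {x : Fin 4 → ℝ} (hx : x ∈ B) (hx3 : |x 3| ≤ 1 - θ)
    (hs : 0 < x 0 ∨ (x 0 = 0 ∧ (0 < x 1 ∨ (x 1 = 0 ∧ 0 ≤ x 2)))) :
    ∃ d ∈ F1 δ η, lit B d x := by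
  have hδ0 : 0 < δ := by linarith
  have hη0 : 0 < η := by nlinarith [mul_pos h0 hδ0]
  have hle := hB.le_one x hx
  have hθη : 0 < θ * η := mul_pos h0 hη0
  have hηδ : 100 * η < δ := by nlinarith
  rcases hs with hs0 | ⟨hs0, hs1 | ⟨hs1, hs2⟩⟩
  · rcases lt_trichotomy (x 1) 0 with hs1 | hs1 | hs1
    · rcases lt_trichotomy (x 2) 0 with hs2 | hs2 | hs2
      · refine lit4 hB hx (d0 := -δ) (d1 := 1) (d2 := η) (d3 := 0) (by simp [F1])
          (InC.E3 hB (c := η / 2) (by positivity))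
          (fun hC => .pos hs0 (hle 0) hC ?_)
          (fun hC => .neg hs1 (hle 1) hC ?_)
          (fun hC => .neg hs2 (hle 2) hC ?_)
          (fun hC => .fill hx3 hC ?_ ?_) <;>
        nlinarith
      · refine lit4 hB hx (d0 := -δ) (d1 := 1) (d2 := η) (d3 := 0) (by simp [F1])
          (InC.plus4 hB (InC.E2 hB (c := 2 * η) (by positivity)) (InC.E3 hB (c := δ / 2) (by positivity)))
          (fun hC => .pos hs0 (hle 0) hC ?_)
          (fun hC => .neg hs1 (hle 1) hC ?_)
          (fun hC => .zero hs2 ?_ ?_)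
          (fun hC => .fill hx3 hC ?_ ?_) <;>
        nlinarith
      · refine lit4 hB hx (d0 := -δ) (d1 := η) (d2 := -1) (d3 := 0) (by simp [F1])
          (InC.E3 hB (c := η / 2) (by positivity))
          (fun hC => .pos hs0 (hle 0) hC ?_)
          (fun hC => .neg hs1 (hle 1) hC ?_)
          (fun hC => .pos hs2 (hle 2) hC ?_)
          (fun hC => .fill hx3 hC ?_ ?_) <;>
        nlinarith
    · rcases lt_trichotomy (x 2) 0 with hs2 | hs2 | hs2
      · refine lit4 hB hx (d0 := -δ) (d1 := -η) (d2 := 1) (d3 := 0) (by simp [F1])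
          (InC.plus4 hB (InC.E1 hB (c := 2 * η) (by positivity)) (InC.E3 hB (c := δ / 2) (by positivity)))
          (fun hC => .pos hs0 (hle 0) hC ?_)
          (fun hC => .zero hs1 ?_ ?_)
          (fun hC => .neg hs2 (hle 2) hC ?_)
          (fun hC => .fill hx3 hC ?_ ?_) <;>
        nlinarith
      · refine lit4 hB hx (d0 := -1) (d1 := -δ) (d2 := -η) (d3 := 0) (by simp [F1])
          (InC.plus4 hB (InC.plus4 hB (InC.E1 hB (c := 2 * δ) (by positivity)) (InC.E2 hB (c := 2 * δ) (by positivity))) (InC.E3 hB (c := 1 / 2) (by positivity)))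
          (fun hC => .pos hs0 (hle 0) hC ?_)
          (fun hC => .zero hs1 ?_ ?_)
          (fun hC => .zero hs2 ?_ ?_)
          (fun hC => .fill hx3 hC ?_ ?_) <;>
        nlinarith
      · refine lit4 hB hx (d0 := -δ) (d1 := η) (d2 := -1) (d3 := 0) (by simp [F1])
          (InC.plus4 hB (InC.E1 hB (c := 2 * η) (by positivity)) (InC.E3 hB (c := δ / 2) (by positivity)))
          (fun hC => .pos hs0 (hle 0) hC ?_)
          (fun hC => .zero hs1 ?_ ?_)
          (fun hC => .pos hs2 (hle 2) hC ?_)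
          (fun hC => .fill hx3 hC ?_ ?_) <;>
        nlinarith
    · rcases lt_trichotomy (x 2) 0 with hs2 | hs2 | hs2
      · refine lit4 hB hx (d0 := -δ) (d1 := -η) (d2 := 1) (d3 := 0) (by simp [F1])
          (InC.E3 hB (c := η / 2) (by positivity))
          (fun hC => .pos hs0 (hle 0) hC ?_)
          (fun hC => .pos hs1 (hle 1) hC ?_)
          (fun hC => .neg hs2 (hle 2) hC ?_)
          (fun hC => .fill hx3 hC ?_ ?_) <;>
        nlinarith
      · refine lit4 hB hx (d0 := -1) (d1 := -δ) (d2 := -η) (d3 := 0) (by simp [F1])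
          (InC.plus4 hB (InC.E2 hB (c := 2 * η) (by positivity)) (InC.E3 hB (c := δ / 2) (by positivity)))
          (fun hC => .pos hs0 (hle 0) hC ?_)
          (fun hC => .pos hs1 (hle 1) hC ?_)
          (fun hC => .zero hs2 ?_ ?_)
          (fun hC => .fill hx3 hC ?_ ?_) <;>
        nlinarith
      · refine lit4 hB hx (d0 := -1) (d1 := -δ) (d2 := -η) (d3 := 0) (by simp [F1])
          (InC.E3 hB (c := η / 2) (by positivity))
          (fun hC => .pos hs0 (hle 0) hC ?_)
          (fun hC => .pos hs1 (hle 1) hC ?_)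
          (fun hC => .pos hs2 (hle 2) hC ?_)
          (fun hC => .fill hx3 hC ?_ ?_) <;>
        nlinarith
  · rcases lt_trichotomy (x 2) 0 with hs2 | hs2 | hs2
    · refine lit4 hB hx (d0 := 0) (d1 := -1) (d2 := 1) (d3 := 0) (by simp [F1])
        (InC.plus4 hB (InC.E0 hB (c := δ) (by positivity)) (InC.E3 hB (c := 1 / 2) (by positivity)))
        (fun hC => .zero hs0 ?_ ?_)
        (fun hC => .pos hs1 (hle 1) hC ?_)
        (fun hC => .neg hs2 (hle 2) hC ?_)
        (fun hC => .fill hx3 hC ?_ ?_) <;>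
      nlinarith
    · refine lit4 hB hx (d0 := δ) (d1 := -1) (d2 := -η) (d3 := 0) (by simp [F1])
        (InC.plus4 hB (InC.plus4 hB (InC.E0 hB (c := 2 * δ) (by positivity)) (InC.E2 hB (c := 2 * δ) (by positivity))) (InC.E3 hB (c := 1 / 2) (by positivity)))
        (fun hC => .zero hs0 ?_ ?_)
        (fun hC => .pos hs1 (hle 1) hC ?_)
        (fun hC => .zero hs2 ?_ ?_)
        (fun hC => .fill hx3 hC ?_ ?_) <;>
      nlinarith
    · refine lit4 hB hx (d0 := δ) (d1 := -1) (d2 := -η) (d3 := 0) (by simp [F1])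
        (InC.plus4 hB (InC.E02 h02 (c := 2 * δ) (by positivity)) (InC.E23 h23 (c := 1 / 2) (by positivity)))
        (fun hC => .zero hs0 ?_ ?_)
        (fun hC => .pos hs1 (hle 1) hC ?_)
        (fun hC => .pos hs2 (hle 2) hC ?_)
        (fun hC => .fill hx3 hC ?_ ?_) <;>
      nlinarith
  · rcases hs2.eq_or_lt with hs2 | hs2
    · replace hs2 := hs2.symm
      have hS : θ * (7 / θ) = 7 := by field_simp
      refine lit4 hB hx (d0 := 1) (d1 := δ) (d2 := η) (d3 := 0) (by simp [F1])
        (InC.plus4 hB (InC.plus4 hB (InC.plus4 hB (InC.E0 hB (c := 2) (by positivity)) (InC.E1 hB (c := 2) (by positivity))) (InC.E2 hB (c := 2) (by positivity))) (InC.E3 hB (c := 7 / θ) (by positivity)))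
        (fun hC => .zero hs0 ?_ ?_)
        (fun hC => .zero hs1 ?_ ?_)
        (fun hC => .zero hs2 ?_ ?_)
        (fun hC => .fill hx3 hC ?_ ?_) <;>
      nlinarith
    · refine lit4 hB hx (d0 := δ) (d1 := η) (d2 := -1) (d3 := 0) (by simp [F1])
        (InC.plus4 hB (InC.plus4 hB (InC.E0 hB (c := 2 * δ) (by positivity)) (InC.E1 hB (c := 2 * δ) (by positivity))) (InC.E3 hB (c := 1 / 2) (by positivity)))
        (fun hC => .zero hs0 ?_ ?_)
        (fun hC => .zero hs1 ?_ ?_)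
        (fun hC => .pos hs2 (hle 2) hC ?_)
        (fun hC => .fill hx3 hC ?_ ?_) <;>
      nlinarith

lemma F1_LS {B : Set (Fin 4 → ℝ)} (hB : Good B) (h01 : stdB 0 + stdB 1 ∈ B)
    (h02 : stdB 0 + stdB 2 ∈ B) (h23 : stdB 2 + stdB 3 ∈ B)
    {θ δ η : ℝ} (h0 : 0 < θ) (h1 : θ < 1) (hδ : θ = 100 * δ) (hη : θ * δ = 100 * η)
    (n03 : ∀ x ∈ B, |x 0| ≤ 1 - θ ∨ |x 3| ≤ 1 - θ)
    (n13 : ∀ x ∈ B, |x 1| ≤ 1 - θ ∨ |x 3| ≤ 1 - θ) : LS B (F1 δ η) := by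
  intro x hx
  have hneg : (∃ d ∈ F1 δ η, lit B d (-x)) → ∃ d ∈ F1 δ η, lit B d x := by
    rintro ⟨d, hd, h⟩
    exact ⟨-d, F1_neg hd, lit_neg h⟩
  by_cases h3 : |x 3| ≤ 1 - θ
  · by_cases hs : 0 < x 0 ∨ (x 0 = 0 ∧ (0 < x 1 ∨ (x 1 = 0 ∧ 0 ≤ x 2)))
    · exact F1_B hB h02 h23 h0 h1 hδ hη hx h3 hs
    · apply hneg
      apply F1_B hB h02 h23 h0 h1 hδ hη (neg_mem hB hx) (by simpa using h3)
      simp only [Pi.neg_apply, Left.neg_pos_iff, neg_eq_zero, Left.nonneg_neg_iff]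
      grind
  · have hx0 := (n03 x hx).resolve_right h3
    have hx1 := (n13 x hx).resolve_right h3
    rcases lt_trichotomy (x 3) 0 with h | h | h
    · apply hneg
      exact F1_A hB h01 h0 h1 hδ hη (neg_mem hB hx) (by simpa using hx0) (by simpa using hx1)
        (by simpa using h)
    · exfalso; apply h3; rw [h]; simp; linarith
    · exact F1_A hB h01 h0 h1 hδ hη hx hx0 hx1 h

set_option maxHeartbeats 4000000 in
lemma F2_core {B : Set (Fin 4 → ℝ)} (hB : Good B)
    (h12 : stdB 1 + stdB 2 ∈ B) (h13 : stdB 1 + stdB 3 ∈ B) {a b τ : ℝ}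
    (hp : ![0, 0, a, b] ∈ B) (hτ : 0 < τ) (hτb : 1 < τ * b) (hτa : τ * (1 - a) < 1)
    {θ δ η : ℝ} (h0 : 0 < θ) (h1 : θ < 1) (hδ0 : 0 < δ) (hδ : 100 * δ ≤ θ)
    (hδτ : 100 * (δ * τ) ≤ θ) (hη : θ * δ = 100 * η)
    {x : Fin 4 → ℝ} (hx : x ∈ B) (hx1 : |x 1| ≤ 1 - θ) (hx3 : |x 3| ≤ 1 - θ) (hs : 0 ≤ x 0) :
    ∃ d ∈ F2 δ η, lit B d x := by
  have hη0 : 0 < η := by nlinarith [mul_pos h0 hδ0]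
  have hle := hB.le_one x hx
  have hθη : 0 < θ * η := mul_pos h0 hη0
  have hθδ : 0 < θ * δ := mul_pos h0 hδ0
  have hδt : 0 < δ * τ := mul_pos hδ0 hτ
  have hθτ : 0 < θ * (δ * τ) := mul_pos h0 hδt
  have hηδ : 100 * η < δ := by nlinarith
  have hb : δ < δ * τ * b := by nlinarith
  have ha : δ * τ * (1 - a) < δ := by nlinarith
  rcases hs.eq_or_lt with hs0 | hs0
  · replace hs0 := hs0.symm
    rcases lt_trichotomy (x 2) 0 with hs2 | hs2 | hs2
    · refine lit4 hB hx (d0 := δ) (d1 := 0) (d2 := 1) (d3 := -η) (by simp [F2])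
        (InC.plus4 hB (InC.E0 hB (c := 2 * δ) (by positivity)) (InC.E13 h13 (c := 1 / 2) (by positivity)))
        (fun hC => .zero hs0 ?_ ?_)
        (fun hC => .fill hx1 hC ?_ ?_)
        (fun hC => .neg hs2 (hle 2) hC ?_)
        (fun hC => .fill hx3 hC ?_ ?_) <;>
      nlinarith
    · have hS : θ * (10 / θ) = 10 := by field_simp
      refine lit4 hB hx (d0 := 1) (d1 := -η) (d2 := -δ) (d3 := -δ) (by simp [F2])
        (InC.plus4 hB (InC.plus4 hB (InC.E0 hB (c := 2) (by positivity)) (InC.E2 hB (c := 2) (by positivity))) (InC.E13 h13 (c := 10 / θ) (by positivity)))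
        (fun hC => .zero hs0 ?_ ?_)
        (fun hC => .fill hx1 hC ?_ ?_)
        (fun hC => .zero hs2 ?_ ?_)
        (fun hC => .fill hx3 hC ?_ ?_) <;>
      nlinarith
    · refine lit4 hB hx (d0 := -δ) (d1 := 0) (d2 := -1) (d3 := η) (by simp [F2])
        (InC.plus4 hB (InC.E0 hB (c := 2 * δ) (by positivity)) (InC.E13 h13 (c := 1 / 2) (by positivity)))
        (fun hC => .zero hs0 ?_ ?_)
        (fun hC => .fill hx1 hC ?_ ?_)
        (fun hC => .pos hs2 (hle 2) hC ?_)
        (fun hC => .fill hx3 hC ?_ ?_) <;>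
      nlinarith
  · rcases lt_trichotomy (x 2) 0 with hs2 | hs2 | hs2
    · rcases lt_trichotomy (x 3) 0 with hs3 | hs3 | hs3
      · refine lit4 hB hx (d0 := -1) (d1 := η) (d2 := δ) (d3 := δ) (by simp [F2])
          (InC.E1 hB (c := δ / 2) (by positivity))
          (fun hC => .pos hs0 (hle 0) hC ?_)
          (fun hC => .fill hx1 hC ?_ ?_)
          (fun hC => .neg hs2 (hle 2) hC ?_)
          (fun hC => .neg hs3 (hle 3) hC ?_) <;>
        nlinarith
      · refine lit4 hB hx (d0 := -1) (d1 := η) (d2 := δ) (d3 := δ) (by simp [F2])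
          (InC.plus4 hB (InC.P hp (c := δ * τ) (by positivity)) (InC.E12 h12 (c := 1 / 2) (by positivity)))
          (fun hC => .pos hs0 (hle 0) hC ?_)
          (fun hC => .fill hx1 hC ?_ ?_)
          (fun hC => .neg hs2 (hle 2) hC ?_)
          (fun hC => .zero hs3 ?_ ?_) <;>
        nlinarith
      · refine lit4 hB hx (d0 := -δ) (d1 := 0) (d2 := η) (d3 := -1) (by simp [F2])
          (InC.E1 hB (c := η / 2) (by positivity))
          (fun hC => .pos hs0 (hle 0) hC ?_)
          (fun hC => .fill hx1 hC ?_ ?_)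
          (fun hC => .neg hs2 (hle 2) hC ?_)
          (fun hC => .pos hs3 (hle 3) hC ?_) <;>
        nlinarith
    · refine lit4 hB hx (d0 := -1) (d1 := η) (d2 := δ) (d3 := δ) (by simp [F2])
        (InC.plus4 hB (InC.E2 hB (c := 2 * δ) (by positivity)) (InC.E13 h13 (c := 1 / 2) (by positivity)))
        (fun hC => .pos hs0 (hle 0) hC ?_)
        (fun hC => .fill hx1 hC ?_ ?_)
        (fun hC => .zero hs2 ?_ ?_)
        (fun hC => .fill hx3 hC ?_ ?_) <;>
      nlinarith
    · refine lit4 hB hx (d0 := -δ) (d1 := 0) (d2 := -1) (d3 := η) (by simp [F2])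
        (InC.E13 h13 (c := δ / 2) (by positivity))
        (fun hC => .pos hs0 (hle 0) hC ?_)
        (fun hC => .fill hx1 hC ?_ ?_)
        (fun hC => .pos hs2 (hle 2) hC ?_)
        (fun hC => .fill hx3 hC ?_ ?_) <;>
      nlinarith

/-- The body with permuted coordinates. -/
def pm (σ : Equiv.Perm (Fin 4)) (B : Set (Fin 4 → ℝ)) : Set (Fin 4 → ℝ) := {x | x ∘ σ ∈ B}

lemma stdB_comp (σ : Equiv.Perm (Fin 4)) (i : Fin 4) :
    (stdB i : Fin 4 → ℝ) ∘ σ = stdB (σ.symm i) := by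
  ext j
  simp only [stdB, Function.comp, Pi.single_apply]
  congr 1
  rw [Equiv.eq_symm_apply]

lemma pair_pm {σ : Equiv.Perm (Fin 4)} {B : Set (Fin 4 → ℝ)} {i j : Fin 4} :
    stdB i + stdB j ∈ pm σ B ↔ stdB (σ.symm i) + stdB (σ.symm j) ∈ B := by
  rw [← stdB_comp, ← stdB_comp]; rfl

lemma Good.pm {B : Set (Fin 4 → ℝ)} (hB : Good B) (σ : Equiv.Perm (Fin 4)) : Good (pm σ B) where
  conv := by
    intro x hx y hy a b ha hb hab
    exact hB.conv hx hy ha hb hab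
  closed := by
    have : Continuous (fun x : Fin 4 → ℝ => x ∘ σ) := by fun_prop
    exact hB.closed.preimage this
  solid := by
    intro x hx y h
    exact hB.solid _ hx _ (fun i => h (σ i))
  basis := by
    intro i
    show _ ∘ _ ∈ B
    rw [stdB_comp]
    exact hB.basis _
  le_one := by
    intro x hx i
    have := hB.le_one _ hx (σ.symm i)
    simpa using this

lemma lit_pm {B : Set (Fin 4 → ℝ)} {σ : Equiv.Perm (Fin 4)} {d y : Fin 4 → ℝ}
    (h : lit (pm σ B) d y) : lit B (d ∘ σ) (y ∘ σ) := by
  obtain ⟨ε, h0, z, hz, h⟩ := h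
  exact ⟨ε, h0, z ∘ σ, hz, fun i => h (σ i)⟩

lemma LS_pm {B D : Set (Fin 4 → ℝ)} {σ : Equiv.Perm (Fin 4)} (h : LS (pm σ B) D) :
    LS B ((fun d => d ∘ σ) '' D) := by
  intro x hx
  have hxx : (x ∘ σ.symm) ∘ σ = x := by ext i; simp
  obtain ⟨d, hd, hl⟩ := h (x ∘ σ.symm) (show _ ∈ B by rwa [hxx])
  refine ⟨d ∘ σ, ⟨d, hd, rfl⟩, ?_⟩
  have := lit_pm hl
  rwa [hxx] at this

lemma F2_swap01 {δ η : ℝ} {d : Fin 4 → ℝ} (h : d ∈ F2 δ η) : d ∘ (Equiv.swap 0 1) ∈ F2 δ η := by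
  have key : ∀ a b c e : ℝ, ![a, b, c, e] ∘ (Equiv.swap (0 : Fin 4) 1) = ![b, a, c, e] := by
    intro a b c e
    ext i; fin_cases i <;> rfl
  simp only [F2, mem_insert_iff, mem_singleton_iff, Matrix.neg_cons, Matrix.neg_empty] at h ⊢
  rcases h with rfl | rfl | rfl | rfl | rfl | rfl | rfl | rfl | rfl | rfl | rfl | rfl <;>
    rw [key] <;> simp

lemma F2_swap23 {δ η : ℝ} {d : Fin 4 → ℝ} (h : d ∈ F2 δ η) : d ∘ (Equiv.swap 2 3) ∈ F2 δ η := by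
  have key : ∀ a b c e : ℝ, ![a, b, c, e] ∘ (Equiv.swap (2 : Fin 4) 3) = ![a, b, e, c] := by
    intro a b c e
    ext i; fin_cases i <;> rfl
  simp only [F2, mem_insert_iff, mem_singleton_iff, Matrix.neg_cons, Matrix.neg_empty] at h ⊢
  rcases h with rfl | rfl | rfl | rfl | rfl | rfl | rfl | rfl | rfl | rfl | rfl | rfl <;>
    rw [key] <;> simp

lemma F2_c1 {B : Set (Fin 4 → ℝ)} (hB : Good B)
    (h12 : stdB 1 + stdB 2 ∈ B) (h13 : stdB 1 + stdB 3 ∈ B) {a b τ : ℝ}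
    (hp : ![0, 0, a, b] ∈ B) (hτ : 0 < τ) (hτb : 1 < τ * b) (hτa : τ * (1 - a) < 1)
    {θ δ η : ℝ} (h0 : 0 < θ) (h1 : θ < 1) (hδ0 : 0 < δ) (hδ : 100 * δ ≤ θ)
    (hδτ : 100 * (δ * τ) ≤ θ) (hη : θ * δ = 100 * η)
    {x : Fin 4 → ℝ} (hx : x ∈ B) (hx1 : |x 1| ≤ 1 - θ) (hx3 : |x 3| ≤ 1 - θ) :
    ∃ d ∈ F2 δ η, lit B d x := by
  rcases le_total 0 (x 0) with hs | hs
  · exact F2_core hB h12 h13 hp hτ hτb hτa h0 h1 hδ0 hδ hδτ hη hx hx1 hx3 hs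
  · obtain ⟨d, hd, h⟩ := F2_core hB h12 h13 hp hτ hτb hτa h0 h1 hδ0 hδ hδτ hη (neg_mem hB hx)
      (by simpa using hx1) (by simpa using hx3) (by simpa using hs)
    exact ⟨-d, F2_neg hd, lit_neg h⟩

lemma F2_c2 {B : Set (Fin 4 → ℝ)} (hB : Good B)
    (h02 : stdB 0 + stdB 2 ∈ B) (h03 : stdB 0 + stdB 3 ∈ B)
    (h12 : stdB 1 + stdB 2 ∈ B) (h13 : stdB 1 + stdB 3 ∈ B) {a b τ : ℝ}
    (hp : ![0, 0, a, b] ∈ B) (hτ : 0 < τ) (hτb : 1 < τ * b) (hτa : τ * (1 - a) < 1)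
    {θ δ η : ℝ} (h0 : 0 < θ) (h1 : θ < 1) (hδ0 : 0 < δ) (hδ : 100 * δ ≤ θ)
    (hδτ : 100 * (δ * τ) ≤ θ) (hη : θ * δ = 100 * η)
    (n01 : ∀ x ∈ B, |x 0| ≤ 1 - θ ∨ |x 1| ≤ 1 - θ)
    {x : Fin 4 → ℝ} (hx : x ∈ B) (hx3 : |x 3| ≤ 1 - θ) :
    ∃ d ∈ F2 δ η, lit B d x := by
  rcases n01 x hx with hx0 | hx1
  · have hxx : (x ∘ Equiv.swap 0 1) ∘ Equiv.swap 0 1 = x := by ext i; simp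
    have hp' : ![0, 0, a, b] ∈ pm (Equiv.swap 0 1) B := by
      show _ ∘ _ ∈ B
      convert hp using 1
      ext i; fin_cases i <;> rfl
    obtain ⟨d, hd, h⟩ := F2_c1 (hB.pm (Equiv.swap 0 1)) (pair_pm.2 h02) (pair_pm.2 h03)
      hp' hτ hτb hτa h0 h1 hδ0 hδ hδτ hη (x := x ∘ Equiv.swap 0 1)
      (show _ ∈ B by rwa [hxx]) hx0 hx3
    have h2 := lit_pm h
    rw [hxx] at h2
    exact ⟨_, F2_swap01 hd, h2⟩
  · exact F2_c1 hB h12 h13 hp hτ hτb hτa h0 h1 hδ0 hδ hδτ hη hx hx1 hx3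

lemma F2_LS {B : Set (Fin 4 → ℝ)} (hB : Good B)
    (h02 : stdB 0 + stdB 2 ∈ B) (h03 : stdB 0 + stdB 3 ∈ B)
    (h12 : stdB 1 + stdB 2 ∈ B) (h13 : stdB 1 + stdB 3 ∈ B) {a b τ τ' : ℝ}
    (hp : ![0, 0, a, b] ∈ B) (hτ : 0 < τ) (hτb : 1 < τ * b) (hτa : τ * (1 - a) < 1)
    (hτ' : 0 < τ') (hτa' : 1 < τ' * a) (hτb' : τ' * (1 - b) < 1)
    {θ δ η : ℝ} (h0 : 0 < θ) (h1 : θ < 1) (hδ0 : 0 < δ) (hδ : 100 * δ ≤ θ)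
    (hδτ : 100 * (δ * τ) ≤ θ) (hδτ' : 100 * (δ * τ') ≤ θ) (hη : θ * δ = 100 * η)
    (n01 : ∀ x ∈ B, |x 0| ≤ 1 - θ ∨ |x 1| ≤ 1 - θ)
    (n23 : ∀ x ∈ B, |x 2| ≤ 1 - θ ∨ |x 3| ≤ 1 - θ) : LS B (F2 δ η) := by
  intro x hx
  rcases n23 x hx with hx2 | hx3
  · have hxx : (x ∘ Equiv.swap 2 3) ∘ Equiv.swap 2 3 = x := by ext i; simp
    have hp' : ![0, 0, b, a] ∈ pm (Equiv.swap 2 3) B := by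
      show _ ∘ _ ∈ B
      convert hp using 1
      ext i; fin_cases i <;> rfl
    obtain ⟨d, hd, h⟩ := F2_c2 (hB.pm (Equiv.swap 2 3)) (pair_pm.2 h03) (pair_pm.2 h02)
      (pair_pm.2 h13) (pair_pm.2 h12)
      hp' hτ' hτa' hτb' h0 h1 hδ0 hδ hδτ' hη (fun y hy => n01 (y ∘ Equiv.swap 2 3) hy) (x := x ∘ Equiv.swap 2 3)
      (show _ ∈ B by rwa [hxx]) hx2
    have h2 := lit_pm h
    rw [hxx] at h2
    exact ⟨_, F2_swap23 hd, h2⟩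
  · exact F2_c2 hB h02 h03 h12 h13 hp hτ hτb hτa h0 h1 hδ0 hδ hδτ hη n01 hx hx3

lemma theta_of {B : Set (Fin 4 → ℝ)} (hB : Good B) {i j : Fin 4} (hij : i ≠ j)
    (h : stdB i + stdB j ∉ B) :
    ∃ θ₀ : ℝ, 0 < θ₀ ∧ θ₀ < 1 ∧ ∀ θ ≤ θ₀, ∀ x ∈ B, |x i| ≤ 1 - θ ∨ |x j| ≤ 1 - θ := by
  have hc : Continuous (fun r : ℝ => r • (stdB i + stdB j : Fin 4 → ℝ)) := by fun_prop
  have ho : IsOpen ((fun r : ℝ => r • (stdB i + stdB j : Fin 4 → ℝ)) ⁻¹' Bᶜ) :=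
    hB.closed.isOpen_compl.preimage hc
  have h1 : ∀ᶠ r in nhdsWithin (1 : ℝ) (Iio 1), r • (stdB i + stdB j : Fin 4 → ℝ) ∉ B :=
    nhdsWithin_le_nhds (ho.mem_nhds (by simpa using h))
  obtain ⟨r, hr, hr0, hr1⟩ := (h1.and (Ioo_mem_nhdsLT (zero_lt_one))).exists
  refine ⟨1 - r, by linarith, by linarith, fun θ hθ x hx => ?_⟩
  by_contra! hcon
  apply hr
  apply hB.solid x hx
  intro k
  by_cases hi : k = i
  · subst hi
    simp [stdB, hij, abs_of_pos hr0]; linarith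
  · by_cases hj : k = j
    · subst hj
      simp [stdB, hij.symm, abs_of_pos hr0]; linarith
    · simp [stdB, hi, hj]

/-- The main conclusion in terms of `LS`. -/
def PP (B : Set (Fin 4 → ℝ)) : Prop :=
  ∃ σ : Equiv.Perm (Fin 4), ∃ δ η : ℝ, 0 < η ∧ η < δ ∧ δ < 1 ∧
    (LS B ((fun d => d ∘ σ) '' F1 δ η) ∨ LS B ((fun d => d ∘ σ) '' F2 δ η))

lemma PP_pm {B : Set (Fin 4 → ℝ)} {τ : Equiv.Perm (Fin 4)} (h : PP (pm τ B)) : PP B := by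
  obtain ⟨σ, δ, η, h1, h2, h3, h⟩ := h
  refine ⟨τ.trans σ, δ, η, h1, h2, h3, ?_⟩
  have key : ∀ D : Set (Fin 4 → ℝ), (fun d : Fin 4 → ℝ => d ∘ (τ.trans σ)) '' D =
      (fun d => d ∘ τ) '' ((fun d => d ∘ σ) '' D) := by
    intro D
    rw [image_image]
    rfl
  rw [key, key]
  exact h.imp LS_pm LS_pm

lemma paw {B : Set (Fin 4 → ℝ)} (hB : Good B) (h01 : stdB 0 + stdB 1 ∈ B)
    (h02 : stdB 0 + stdB 2 ∈ B) (h23 : stdB 2 + stdB 3 ∈ B)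
    (h03 : stdB 0 + stdB 3 ∉ B) (h13 : stdB 1 + stdB 3 ∉ B) : PP B := by
  obtain ⟨t1, a1, b1, c1⟩ := theta_of hB (by decide) h03
  obtain ⟨t2, a2, b2, c2⟩ := theta_of hB (by decide) h13
  have h0 : 0 < min t1 t2 := lt_min a1 a2
  have h1 : min t1 t2 < 1 := (min_le_left _ _).trans_lt b1
  have e1 := c1 _ (min_le_left t1 t2)
  have e2 := c2 _ (min_le_right t1 t2)
  generalize min t1 t2 = θ at *
  refine ⟨1, θ / 100, θ * (θ / 100) / 100, by positivity, by nlinarith, by linarith, Or.inl ?_⟩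
  have := F1_LS hB h01 h02 h23 h0 h1 (δ := θ / 100) (η := θ * (θ / 100) / 100) (by ring) (by ring)
    e1 e2
  simpa using this

lemma cyc {B : Set (Fin 4 → ℝ)} (hB : Good B)
    (h02 : stdB 0 + stdB 2 ∈ B) (h03 : stdB 0 + stdB 3 ∈ B)
    (h12 : stdB 1 + stdB 2 ∈ B) (h13 : stdB 1 + stdB 3 ∈ B)
    (h01 : stdB 0 + stdB 1 ∉ B) (h23 : stdB 2 + stdB 3 ∉ B)
    (hp : ∃ x ∈ B, 1 < |x 2| + |x 3|) : PP B := by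
  obtain ⟨x, hx, hab⟩ := hp
  have hq : ![0, 0, |x 2|, |x 3|] ∈ B := by
    apply hB.solid x hx
    intro i; fin_cases i <;> simp
  have ha1 := hB.le_one x hx 2
  have hb1 := hB.le_one x hx 3
  generalize |x 2| = a at *
  generalize |x 3| = b at *
  obtain ⟨t1, a1, b1, c1⟩ := theta_of hB (by decide) h01
  obtain ⟨t2, a2, b2, c2⟩ := theta_of hB (by decide) h23
  have h0 : 0 < min t1 t2 := lt_min a1 a2
  have h1 : min t1 t2 < 1 := (min_le_left _ _).trans_lt b1
  have e1 := c1 _ (min_le_left t1 t2)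
  have e2 := c2 _ (min_le_right t1 t2)
  generalize min t1 t2 = θ at *
  have p1 : 0 < b + 1 - a := by linarith
  have p2 : 0 < a + 1 - b := by linarith
  set τ := 2 / (b + 1 - a) with hτ
  set τ' := 2 / (a + 1 - b) with hτ'
  have q1 : 0 < τ := by positivity
  have q2 : 0 < τ' := by positivity
  have r1 : τ * (b + 1 - a) = 2 := by rw [hτ]; field_simp
  have r2 : τ' * (a + 1 - b) = 2 := by rw [hτ']; field_simp
  have hM : 0 < 100 * (1 + τ + τ') := by positivity
  set δ := θ / (100 * (1 + τ + τ')) with hδ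
  have hδ0 : 0 < δ := by positivity
  have hδM : δ * (100 * (1 + τ + τ')) = θ := by rw [hδ]; field_simp
  have s1 : 0 < δ * τ := by positivity
  have s2 : 0 < δ * τ' := by positivity
  refine ⟨1, δ, θ * δ / 100, by positivity, by nlinarith, by nlinarith, Or.inr ?_⟩
  have := F2_LS hB h02 h03 h12 h13 hq q1 (by nlinarith) (by nlinarith) q2 (by nlinarith)
    (by nlinarith) h0 h1 hδ0 (δ := δ) (η := θ * δ / 100) (by nlinarith) (by nlinarith)
    (by nlinarith) (by ring) e1 e2
  simpa using this

/-- The linear map taking the cube to the product of two cross-polygons. -/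
noncomputable def rot : (Fin 4 → ℝ) ≃ₗ[ℝ] (Fin 4 → ℝ) where
  toFun y := ![(y 0 + y 1) / 2, (y 0 - y 1) / 2, (y 2 + y 3) / 2, (y 2 - y 3) / 2]
  invFun u := ![u 0 + u 1, u 0 - u 1, u 2 + u 3, u 2 - u 3]
  map_add' x y := by ext i; fin_cases i <;> simp <;> ring
  map_smul' c y := by ext i; fin_cases i <;> simp <;> ring
  left_inv y := by ext i; fin_cases i <;> simp <;> ring
  right_inv y := by ext i; fin_cases i <;> simp <;> ring

lemma par_of {B : Set (Fin 4 → ℝ)} (hB : Good B)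
    (h02 : stdB 0 + stdB 2 ∈ B) (h03 : stdB 0 + stdB 3 ∈ B)
    (h12 : stdB 1 + stdB 2 ∈ B) (h13 : stdB 1 + stdB 3 ∈ B)
    (hp : ∀ x ∈ B, |x 2| + |x 3| ≤ 1) (hq : ∀ x ∈ B, |x 0| + |x 1| ≤ 1) :
    IsParallelepiped B := by
  refine ⟨rot.toAffineEquiv, ?_⟩
  ext x
  constructor
  · intro hx
    refine ⟨rot.symm x, ?_, by simp⟩
    have e1 := hp x hx
    have e2 := hq x hx
    have a0 := abs_le.1 (le_refl |x 0|)
    have a1 := abs_le.1 (le_refl |x 1|)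
    have a2 := abs_le.1 (le_refl |x 2|)
    have a3 := abs_le.1 (le_refl |x 3|)
    constructor
    · intro i; fin_cases i <;> simp [rot] <;> linarith
    · intro i; fin_cases i <;> simp [rot] <;> linarith
  · rintro ⟨y, hy, rfl⟩
    have l : ∀ i, -1 ≤ y i := hy.1
    have u : ∀ i, y i ≤ 1 := hy.2
    have key : ∀ s t : ℝ, -1 ≤ s → s ≤ 1 → -1 ≤ t → t ≤ 1 →
        |(s + t) / 2| + |(s - t) / 2| ≤ 1 := by
      intro s t h1 h2 h3 h4
      rcases abs_cases ((s + t) / 2) with h | h <;> rcases abs_cases ((s - t) / 2) with h' | h' <;>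
        linarith
    have k1 := key _ _ (l 0) (u 0) (l 1) (u 1)
    have k2 := key _ _ (l 2) (u 2) (l 3) (u 3)
    set α := |(y 0 + y 1) / 2| with hα
    set β := |(y 2 + y 3) / 2| with hβ
    have a0 : 0 ≤ α := abs_nonneg _
    have b0 : 0 ≤ β := abs_nonneg _
    have a1 : 0 ≤ 1 - α := by linarith [abs_nonneg ((y 0 - y 1) / 2)]
    have b1 : 0 ≤ 1 - β := by linarith [abs_nonneg ((y 2 - y 3) / 2)]
    have := InC.plus4 hB (InC.plus4 hB (InC.plus4 hB (InC.E02 h02 (mul_nonneg a0 b0))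
      (InC.E03 h03 (mul_nonneg a0 b1))) (InC.E12 h12 (mul_nonneg a1 b0)))
      (InC.E13 h13 (mul_nonneg a1 b1))
    obtain ⟨-, q, hq, he⟩ := this
    have hC : α * β + α * (1 - β) + (1 - α) * β + (1 - α) * (1 - β) = 1 := by ring
    rw [hC, one_smul] at he
    apply hB.solid q hq
    rw [← he]
    intro i
    fin_cases i
    · simp [rot]; rw [← hα]; apply le_abs_self _ |>.trans' ; linarith
    · simp [rot]; apply le_abs_self _ |>.trans' ; linarith
    · simp [rot]; rw [← hβ]; apply le_abs_self _ |>.trans' ; linarith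
    · simp [rot]; apply le_abs_self _ |>.trans' ; linarith

lemma par_pm {B : Set (Fin 4 → ℝ)} {σ : Equiv.Perm (Fin 4)} (h : IsParallelepiped (pm σ B)) :
    IsParallelepiped B := by
  obtain ⟨T, hT⟩ := h
  refine ⟨T.trans (LinearEquiv.funCongrLeft ℝ ℝ σ).toAffineEquiv, ?_⟩
  have : ⇑(T.trans (LinearEquiv.funCongrLeft ℝ ℝ σ).toAffineEquiv) =
      (fun x : Fin 4 → ℝ => x ∘ σ) ∘ T := by
    ext x i
    simp [LinearEquiv.funCongrLeft, LinearMap.funLeft]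
  rw [this, image_comp, ← hT]
  ext x
  constructor
  · intro hx
    have hxx : (x ∘ σ.symm) ∘ σ = x := by ext i; simp
    exact ⟨x ∘ σ.symm, show _ ∈ B by rwa [hxx], hxx⟩
  · rintro ⟨y, hy, rfl⟩
    exact hy

lemma cyc' {B : Set (Fin 4 → ℝ)} (hB : Good B)
    (h02 : stdB 0 + stdB 2 ∈ B) (h03 : stdB 0 + stdB 3 ∈ B)
    (h12 : stdB 1 + stdB 2 ∈ B) (h13 : stdB 1 + stdB 3 ∈ B)
    (h01 : stdB 0 + stdB 1 ∉ B) (h23 : stdB 2 + stdB 3 ∉ B)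
    (hpar : ¬ IsParallelepiped B) : PP B := by
  by_cases hp : ∃ x ∈ B, 1 < |x 2| + |x 3|
  · exact cyc hB h02 h03 h12 h13 h01 h23 hp
  by_cases hq : ∃ x ∈ B, 1 < |x 0| + |x 1|
  · obtain ⟨x, hx, h⟩ := hq
    let σ : Equiv.Perm (Fin 4) := Equiv.swap 0 2 * Equiv.swap 1 3
    apply PP_pm (τ := σ)
    have hxx : (x ∘ σ) ∘ σ = x := by ext i; fin_cases i <;> rfl
    have s0 : σ.symm 0 = 2 := by decide
    have s1 : σ.symm 1 = 3 := by decide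
    have s2 : σ.symm 2 = 0 := by decide
    have s3 : σ.symm 3 = 1 := by decide
    apply cyc (hB.pm σ)
    · rw [pair_pm, s0, s2, add_comm]; exact h02
    · rw [pair_pm, s0, s3, add_comm]; exact h12
    · rw [pair_pm, s1, s2, add_comm]; exact h03
    · rw [pair_pm, s1, s3, add_comm]; exact h13
    · rw [pair_pm, s0, s1]; exact h23
    · rw [pair_pm, s2, s3]; exact h01
    · exact ⟨x ∘ σ, show _ ∈ B by rwa [hxx], h⟩
  · push Not at hp hq
    exact absurd (par_of hB h02 h03 h12 h13 hp hq) hpar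

/-- Adjacency matrix from six booleans. -/
def adj (a b c d e f : Bool) : Fin 4 → Fin 4 → Bool :=
  ![![false, a, b, c], ![a, false, d, e], ![b, d, false, f], ![c, e, f, false]]

lemma comb : ∀ a b c d e f : Bool,
    a.toNat + b.toNat + c.toNat + d.toNat + e.toNat + f.toNat = 4 →
    ∃ τ : Equiv.Perm (Fin 4),
      (adj a b c d e f (τ 0) (τ 1) = true ∧ adj a b c d e f (τ 0) (τ 2) = true ∧
       adj a b c d e f (τ 2) (τ 3) = true ∧
       adj a b c d e f (τ 0) (τ 3) = false ∧ adj a b c d e f (τ 1) (τ 3) = false) ∨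
      (adj a b c d e f (τ 0) (τ 2) = true ∧ adj a b c d e f (τ 0) (τ 3) = true ∧
       adj a b c d e f (τ 1) (τ 2) = true ∧ adj a b c d e f (τ 1) (τ 3) = true ∧
       adj a b c d e f (τ 0) (τ 1) = false ∧ adj a b c d e f (τ 2) (τ 3) = false) := by
  decide +kernel

lemma main_PP {B : Set (Fin 4 → ℝ)} (hB : Good B) (hpar : ¬ IsParallelepiped B)
    (hfour : ({p : Fin 4 × Fin 4 | p.1 < p.2 ∧ stdB p.1 + stdB p.2 ∈ B}).ncard = 4) :
    PP B := by
  classical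
  let g : Fin 4 → Fin 4 → Bool := fun i j => decide (stdB i + stdB j ∈ B)
  have hset : {p : Fin 4 × Fin 4 | p.1 < p.2 ∧ stdB p.1 + stdB p.2 ∈ B} =
      ↑(Finset.univ.filter fun p : Fin 4 × Fin 4 => p.1 < p.2 ∧ g p.1 p.2 = true) := by
    ext p; simp [g]
  rw [hset, Set.ncard_coe_finset, Finset.card_filter, Fintype.sum_prod_type] at hfour
  have ht : ∀ i j, (g i j).toNat = if g i j = true then 1 else 0 := by
    intro i j; cases g i j <;> rfl
  have hsum : (g 0 1).toNat + (g 0 2).toNat + (g 0 3).toNat + (g 1 2).toNat + (g 1 3).toNat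
      + (g 2 3).toNat = 4 := by
    simp only [Fin.sum_univ_four] at hfour
    simp only [ht]
    simp at hfour
    linarith
  have hadj : ∀ i j, i ≠ j → adj (g 0 1) (g 0 2) (g 0 3) (g 1 2) (g 1 3) (g 2 3) i j =
      decide (stdB i + stdB j ∈ B) := by
    intro i j hij
    fin_cases i <;> fin_cases j <;> first | exact absurd rfl hij | rfl | skip
    all_goals (rw [add_comm]; rfl)
  obtain ⟨τ, h⟩ := comb _ _ _ _ _ _ hsum
  have hne : ∀ i j, i ≠ j → τ i ≠ τ j := fun i j h => τ.injective.ne h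
  rw [hadj _ _ (hne 0 1 (by decide)), hadj _ _ (hne 0 2 (by decide)),
    hadj _ _ (hne 0 3 (by decide)), hadj _ _ (hne 1 2 (by decide)),
    hadj _ _ (hne 1 3 (by decide)), hadj _ _ (hne 2 3 (by decide))] at h
  simp only [decide_eq_true_eq, decide_eq_false_iff_not] at h
  have hG := hB.pm τ.symm
  apply PP_pm (τ := τ.symm)
  rcases h with ⟨h1, h2, h3, h4, h5⟩ | ⟨h1, h2, h3, h4, h5, h6⟩
  · exact paw hG (pair_pm.2 h1) (pair_pm.2 h2) (pair_pm.2 h3) (fun h => h4 (pair_pm.1 h))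
      (fun h => h5 (pair_pm.1 h))
  · exact cyc' hG (pair_pm.2 h1) (pair_pm.2 h2) (pair_pm.2 h3) (pair_pm.2 h4)
      (fun h => h5 (pair_pm.1 h)) (fun h => h6 (pair_pm.1 h)) (fun h => hpar (par_pm h))

lemma solid_of {B : Set (Fin 4 → ℝ)} (hc : Convex ℝ B) (hu : Unconditional B)
    (x : Fin 4 → ℝ) (hx : x ∈ B) (y : Fin 4 → ℝ) (h : ∀ i, |y i| ≤ |x i|) : y ∈ B := by
  have step : ∀ z ∈ B, ∀ i, ∀ t : ℝ, |t| ≤ |z i| → Function.update z i t ∈ B := by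
    intro z hz i t ht
    have hf : (fun j => (if j = i then (-1 : ℝ) else 1) * z j) ∈ B :=
      hu z hz (fun j => if j = i then (-1 : ℝ) else 1)
        (fun j => by by_cases hj : j = i <;> simp [hj])
    by_cases h0 : z i = 0
    · have : t = 0 := by simpa [h0] using ht
      rw [this, ← h0, Function.update_eq_self]
      exact hz
    · have hs : |t / z i| ≤ 1 := by
        rw [abs_div]
        exact div_le_one_of_le₀ ht (abs_nonneg _)
      obtain ⟨s1, s2⟩ := abs_le.1 hs
      have := hc hz hf (a := (1 + t / z i) / 2) (b := (1 - t / z i) / 2) (by linarith)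
        (by linarith) (by ring)
      convert this using 1
      ext j
      by_cases hj : j = i
      · subst hj
        simp
        field_simp
        ring
      · simp [hj]
        ring
  have main : ∀ s : Finset (Fin 4), (fun i => if i ∈ s then y i else x i) ∈ B := by
    intro s
    induction s using Finset.induction_on with
    | empty => simpa using hx
    | insert a s ha ih =>
      have := step _ ih a (y a) (by simpa [ha] using h a)
      convert this using 1
      ext j
      by_cases hj : j = a
      · subst hj; simp
      · simp [hj]
  simpa using main Finset.univ

lemma interior_of {B : Set (Fin 4 → ℝ)}
    (hs : ∀ x ∈ B, ∀ y : Fin 4 → ℝ, (∀ i, |y i| ≤ |x i|) → y ∈ B)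
    {y z : Fin 4 → ℝ} (hz : z ∈ B) (h : ∀ i, |y i| < z i) : y ∈ interior B := by
  rw [mem_interior]
  refine ⟨{w | ∀ i, |w i| < z i}, fun w hw => hs z hz w fun i => ((hw i).trans_le (le_abs_self _)).le,
    ?_, h⟩
  simp only [ofPred_forall]
  apply isOpen_iInter_of_finite
  intro i
  exact isOpen_lt (by fun_prop) continuous_const

lemma good_of {B : Set (Fin 4 → ℝ)} (hB : memU B) : Good B := by
  obtain ⟨⟨hc, hk, -⟩, hu, hf⟩ := hB
  have hs := solid_of hc hu
  have hb : ∀ i, stdB i ∈ B := fun i => hk.isClosed.frontier_subset (hf i)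
  refine ⟨hc, hk.isClosed, hs, hb, ?_⟩
  intro x hx i
  by_contra! hcon
  apply (hf i).2
  have hax : (fun j => |x j|) ∈ B := hs x hx _ (fun j => by simp)
  have hones : (fun _ => 1 / 4 : Fin 4 → ℝ) ∈ B := by
    have h1 := InC.plus hc (InC.plus hc (InC.plus hc (InC.of_mem (hb 0) (c := 1 / 4) (by norm_num))
      (InC.of_mem (hb 1) (c := 1 / 4) (by norm_num))) (InC.of_mem (hb 2) (c := 1 / 4) (by norm_num)))
      (InC.of_mem (hb 3) (c := 1 / 4) (by norm_num))
    obtain ⟨-, q, hq, he⟩ := h1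
    convert hq using 1
    have : (1 / 4 + 1 / 4 + 1 / 4 + 1 / 4 : ℝ) = 1 := by norm_num
    rw [this, one_smul] at he
    rw [← he]
    ext j; fin_cases j <;> simp [stdB]
  have hi : 0 < |x i| := by linarith
  set t : ℝ := (|x i| - 1) / |x i| with ht
  have ht0 : 0 < t := div_pos (by linarith) hi
  have ht1 : t ≤ 1 := by rw [ht, div_le_one hi]; linarith
  have htx : t * |x i| = |x i| - 1 := by rw [ht]; field_simp
  refine interior_of hs (hc hax hones (a := 1 - t) (b := t) (by linarith) ht0.le (by ring)) ?_
  intro j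
  by_cases hj : j = i
  · subst hj
    simp [stdB]
    nlinarith
  · simp [stdB, hj]
    have : 0 ≤ (1 - t) * |x j| := mul_nonneg (by linarith) (abs_nonneg _)
    linarith

lemma illum_of_LS {B D : Set (Fin 4 → ℝ)} (hB : Good B) (h : LS B D) : IlluminatesSet B D := by
  intro x hx
  obtain ⟨d, hd, ε, h0, z, hz, h⟩ := h x (hB.closed.frontier_subset hx)
  exact ⟨d, hd, ε, h0, interior_of hB.solid hz h⟩

lemma num_le {B : Set (Fin 4 → ℝ)} (σ : Equiv.Perm (Fin 4)) (l : List (Fin 4 → ℝ))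
    (hl : l.length ≤ 14) (h0 : ∀ d ∈ l, d ≠ 0)
    (h : IlluminatesSet B ((fun d => d ∘ σ) '' {d | d ∈ l})) : illumNumber B ≤ 14 := by
  classical
  let D : Finset (Fin 4 → ℝ) := (l.map (fun d => d ∘ σ)).toFinset
  have hD : D.card ≤ 14 := (List.toFinset_card_le _).trans (by simpa using hl)
  refine le_trans (Nat.sInf_le ⟨D, rfl, ?_, ?_⟩) hD
  · intro d hd
    simp only [D, List.mem_toFinset, List.mem_map] at hd
    obtain ⟨d', hd', rfl⟩ := hd
    intro hz
    apply h0 d' hd'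
    ext i
    have := congrFun hz (σ.symm i)
    simpa using this
  · convert h using 1
    ext d
    simp [D]

lemma ne_zero_of {d : Fin 4 → ℝ} (i : Fin 4) (h : d i ≠ 0) : d ≠ 0 := by
  rintro rfl
  exact h rfl

lemma num_F1 {B : Set (Fin 4 → ℝ)} {σ : Equiv.Perm (Fin 4)} {δ η : ℝ}
    (h : IlluminatesSet B ((fun d => d ∘ σ) '' F1 δ η)) : illumNumber B ≤ 14 := by
  refine num_le σ [![1, δ, η, 0], -![1, δ, η, 0],
            ![δ, -1, -η, 0], -![δ, -1, -η, 0],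
            ![δ, -η, 1, 0], -![δ, -η, 1, 0],
            ![δ, η, -1, 0], -![δ, η, -1, 0],
            ![0, η, δ, 1], -![0, η, δ, 1],
            ![0, -η, -δ, 1], -![0, -η, -δ, 1],
            ![0, 1, -1, 0], -![0, 1, -1, 0]] (by simp) ?_ ?_
  · intro d hd
    simp only [List.mem_cons, List.not_mem_nil, or_false] at hd
    rcases hd with rfl | rfl | rfl | rfl | rfl | rfl | rfl | rfl | rfl | rfl | rfl | rfl | rfl | rfl <;>
      first
      | (apply ne_zero_of 0; simp; done)
      | (apply ne_zero_of 1; simp; done)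
      | (apply ne_zero_of 2; simp; done)
      | (apply ne_zero_of 3; simp; done)
  · convert h using 2
    ext d
    simp only [F1, List.mem_cons, List.not_mem_nil, or_false, mem_ofPred_eq, mem_insert_iff,
      mem_singleton_iff]

lemma num_F2 {B : Set (Fin 4 → ℝ)} {σ : Equiv.Perm (Fin 4)} {δ η : ℝ}
    (h : IlluminatesSet B ((fun d => d ∘ σ) '' F2 δ η)) : illumNumber B ≤ 14 := by
  refine num_le σ [![1, -η, -δ, -δ], -![1, -η, -δ, -δ],
            ![-η, 1, -δ, -δ], -![-η, 1, -δ, -δ],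
            ![δ, 0, 1, -η], -![δ, 0, 1, -η],
            ![δ, 0, -η, 1], -![δ, 0, -η, 1],
            ![0, δ, 1, -η], -![0, δ, 1, -η],
            ![0, δ, -η, 1], -![0, δ, -η, 1]] (by simp) ?_ ?_
  · intro d hd
    simp only [List.mem_cons, List.not_mem_nil, or_false] at hd
    rcases hd with rfl | rfl | rfl | rfl | rfl | rfl | rfl | rfl | rfl | rfl | rfl | rfl <;>
      first
      | (apply ne_zero_of 0; simp; done)
      | (apply ne_zero_of 1; simp; done)
      | (apply ne_zero_of 2; simp; done)
      | (apply ne_zero_of 3; simp; done)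
  · convert h using 2
    ext d
    simp only [F2, List.mem_cons, List.not_mem_nil, or_false, mem_ofPred_eq, mem_insert_iff,
      mem_singleton_iff]

end St19

/-- If `B ∈ 𝒰⁴` is not a parallelepiped, exactly four of the six
unordered pairs `{i,j}` satisfy `e_i + e_j ∈ B`, and `B` contains no sum of three
distinct basis vectors, then for some coordinate permutation `σ` and some
`0 < η < δ < 1`, the image under `σ` of one of the two explicit families `F₁`
(14 directions) or `F₂` (12 directions) illuminates `B`; in particular
`𝕀(B) ≤ 14 = 2⁴ - 2`. -/
theorem stmt19 (B : Set (Fin 4 → ℝ)) (hB : memU B)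
    (hpar : ¬ IsParallelepiped B)
    (hfour : ({p : Fin 4 × Fin 4 | p.1 < p.2 ∧ stdB p.1 + stdB p.2 ∈ B}).ncard
      = 4)
    (htriple : ∀ j₁ j₂ j₃ : Fin 4, j₁ ≠ j₂ → j₁ ≠ j₃ → j₂ ≠ j₃ →
      stdB j₁ + stdB j₂ + stdB j₃ ∉ B) :
    ∃ σ : Equiv.Perm (Fin 4), ∃ δ η : ℝ, 0 < η ∧ η < δ ∧ δ < 1 ∧
      (IlluminatesSet B ((fun d => d ∘ σ) ''
          ({![1, δ, η, 0], -![1, δ, η, 0],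
            ![δ, -1, -η, 0], -![δ, -1, -η, 0],
            ![δ, -η, 1, 0], -![δ, -η, 1, 0],
            ![δ, η, -1, 0], -![δ, η, -1, 0],
            ![0, η, δ, 1], -![0, η, δ, 1],
            ![0, -η, -δ, 1], -![0, -η, -δ, 1],
            ![0, 1, -1, 0], -![0, 1, -1, 0]} : Set (Fin 4 → ℝ))) ∨
        IlluminatesSet B ((fun d => d ∘ σ) ''
          ({![1, -η, -δ, -δ], -![1, -η, -δ, -δ],
            ![-η, 1, -δ, -δ], -![-η, 1, -δ, -δ],
            ![δ, 0, 1, -η], -![δ, 0, 1, -η],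
            ![δ, 0, -η, 1], -![δ, 0, -η, 1],
            ![0, δ, 1, -η], -![0, δ, 1, -η],
            ![0, δ, -η, 1], -![0, δ, -η, 1]} : Set (Fin 4 → ℝ)))) ∧
      illumNumber B ≤ 14 := by
  have hG := St19.good_of hB
  obtain ⟨σ, δ, η, h1, h2, h3, h⟩ := St19.main_PP hG hpar hfour
  refine ⟨σ, δ, η, h1, h2, h3, ?_⟩
  rcases h with h | h
  · have hI := St19.illum_of_LS hG h
    exact ⟨Or.inl hI, St19.num_F1 hI⟩
  · have hI := St19.illum_of_LS hG h
    exact ⟨Or.inr hI, St19.num_F2 hI⟩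
end
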